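/- arXiv:1811.08470 — 5 statements merged into one kernel-verified Lean document; each statement's English description precedes it below -/
import Mathlib

section
/- Let X, X̃, U₁, U₂ be Banach spaces, let T be a C₀-semigroup of type (M,ω) on X with M ≥ 1 and ω > 0, with extrapolation setting (X₋₁, ι, T₋₁), and let p, q ∈ [1,∞). Suppose B₁ ∈ L(X̃, X₋₁) is L^p-admissible and B₂ ∈ L(U₂, X₋₁) is L^q-admissible for the rescaled semigroup (e^{ωt/2}T(t))_{t≥0} with uniformly bounded admissibility constants, and let F satisfy the standing assumptions with bound m > 0. Then there exist a function β of class KL and functions θ₁, θ₂ of class K∞ such that for every x₀ ∈ X, u₁ ∈ L^p(0,∞;U₁) and u₂ ∈ L^q(0,∞;U₂) the unique global mild solution x of Σ(A,[B₁,B₂],F) satisfies, for all t ≥ 0: ‖x(t)‖ ≤ β(‖x₀‖, t) + θ₁(∫₀ᵗ ‖u₁(s)‖^p ds) + θ₂(∫₀ᵗ ‖u₂(s)‖^q ds). In particular, the system Σ(A,[B₁,B₂],F) is integral input-to-state stable. -/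
open MeasureTheory Set Filter

/-- A `C₀`-semigroup on a Banach space `X`. -/
structure C0Semigroup (X : Type*) [NormedAddCommGroup X] [NormedSpace ℝ X] where
  toFun : ℝ → X →L[ℝ] X
  map_zero' : toFun 0 = ContinuousLinearMap.id ℝ X
  map_add' : ∀ s t : ℝ, 0 ≤ s → 0 ≤ t → toFun (s + t) = (toFun s).comp (toFun t)
  continuousOn_apply' : ∀ x : X, ContinuousOn (fun t => toFun t x) (Set.Ici 0)

instance {X : Type*} [NormedAddCommGroup X] [NormedSpace ℝ X] :
    CoeFun (C0Semigroup X) (fun _ => ℝ → X →L[ℝ] X) := ⟨C0Semigroup.toFun⟩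

/-- An extrapolation setting `(X₋₁, ι, T₋₁)` for a `C₀`-semigroup `T` on `X`. -/
structure Extrapolation {X : Type*} [NormedAddCommGroup X] [NormedSpace ℝ X]
    (Xm : Type*) [NormedAddCommGroup Xm] [NormedSpace ℝ Xm]
    (T : C0Semigroup X) where
  ι : X →L[ℝ] Xm
  ι_injective : Function.Injective ι
  ι_denseRange : DenseRange ι
  Tm : C0Semigroup Xm
  compat : ∀ t : ℝ, 0 ≤ t → ∀ x : X, Tm t (ι x) = ι (T t x)

/-- `L^p`-admissibility (for `p ∈ [1,∞)`) of `B : U → X₋₁` with respect to a family `S`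
of operators on `X₋₁` (typically the extrapolated, possibly rescaled, semigroup),
with admissibility constants `C t`. -/
def IsLpAdmissibleFor {X Xm U : Type*} [NormedAddCommGroup X] [NormedSpace ℝ X]
    [NormedAddCommGroup Xm] [NormedSpace ℝ Xm] [NormedAddCommGroup U] [NormedSpace ℝ U]
    (S : ℝ → Xm →L[ℝ] Xm) (ι : X →L[ℝ] Xm) (p : ℝ) (B : U →L[ℝ] Xm) (C : ℝ → ℝ) : Prop :=
  ∀ t : ℝ, 0 < t → ∀ u : ℝ → U,
    AEStronglyMeasurable u (volume.restrict (Set.Ioo 0 t)) →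
    IntegrableOn (fun s => ‖u s‖ ^ p) (Set.Ioo 0 t) →
    IntegrableOn (fun s => S (t - s) (B (u s))) (Set.Ioo 0 t) ∧
    ∃ y : X, ι y = (∫ s in Set.Ioo 0 t, S (t - s) (B (u s))) ∧
      ‖y‖ ≤ C t * (∫ s in Set.Ioo 0 t, ‖u s‖ ^ p) ^ (1 / p)

/-- The standing assumptions on the bilinearity `F : X × U₁ → X̃` with bound `m`. -/
structure StandingAssumptions {X U₁ Xt : Type*} [NormedAddCommGroup X] [NormedSpace ℝ X]
    [NormedAddCommGroup U₁] [NormedSpace ℝ U₁] [NormedAddCommGroup Xt] [NormedSpace ℝ Xt]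
    (m : ℝ) (F : X → U₁ → Xt) : Prop where
  norm_bound : ∀ x u, ‖F x u‖ ≤ m * ‖x‖ * ‖u‖
  lipschitz : ∀ Xb : Set X, Bornology.IsBounded Xb →
    ∃ L > 0, ∀ x ∈ Xb, ∀ y ∈ Xb, ∀ u, ‖F x u - F y u‖ ≤ L * ‖u‖ * ‖x - y‖
  stronglyMeasurable_comp : ∀ (f : ℝ → X) (g : ℝ → U₁),
    StronglyMeasurable f → StronglyMeasurable g →
    StronglyMeasurable (fun s => F (f s) (g s))

/-- A mild solution of `Σ(A,[B₁,B₂],F)` on `[t₀,t₁]` with initial value `x₀`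
and inputs `u₁, u₂`. -/
def IsMildSolutionOn {X Xt U₁ U₂ Xm : Type*}
    [NormedAddCommGroup X] [NormedSpace ℝ X]
    [NormedAddCommGroup Xt] [NormedSpace ℝ Xt]
    [NormedAddCommGroup U₁] [NormedSpace ℝ U₁]
    [NormedAddCommGroup U₂] [NormedSpace ℝ U₂]
    [NormedAddCommGroup Xm] [NormedSpace ℝ Xm]
    (T : C0Semigroup X) (E : Extrapolation Xm T)
    (B₁ : Xt →L[ℝ] Xm) (B₂ : U₂ →L[ℝ] Xm) (F : X → U₁ → Xt)
    (x₀ : X) (u₁ : ℝ → U₁) (u₂ : ℝ → U₂) (t₀ t₁ : ℝ) (x : ℝ → X) : Prop :=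
  ContinuousOn x (Set.Icc t₀ t₁) ∧
  ∀ t ∈ Set.Icc t₀ t₁,
    IntegrableOn (fun s => E.Tm (t - s) (B₁ (F (x s) (u₁ s)) + B₂ (u₂ s))) (Set.Ioo t₀ t) ∧
    E.ι (x t) = E.ι (T (t - t₀) x₀) +
      ∫ s in Set.Ioo t₀ t, E.Tm (t - s) (B₁ (F (x s) (u₁ s)) + B₂ (u₂ s))

/-- A global mild solution of `Σ(A,[B₁,B₂],F)`. -/
def IsGlobalMildSolution {X Xt U₁ U₂ Xm : Type*}
    [NormedAddCommGroup X] [NormedSpace ℝ X]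
    [NormedAddCommGroup Xt] [NormedSpace ℝ Xt]
    [NormedAddCommGroup U₁] [NormedSpace ℝ U₁]
    [NormedAddCommGroup U₂] [NormedSpace ℝ U₂]
    [NormedAddCommGroup Xm] [NormedSpace ℝ Xm]
    (T : C0Semigroup X) (E : Extrapolation Xm T)
    (B₁ : Xt →L[ℝ] Xm) (B₂ : U₂ →L[ℝ] Xm) (F : X → U₁ → Xt)
    (x₀ : X) (u₁ : ℝ → U₁) (u₂ : ℝ → U₂) (x : ℝ → X) : Prop :=
  ContinuousOn x (Set.Ici 0) ∧
  ∀ t₁ : ℝ, 0 < t₁ → IsMildSolutionOn T E B₁ B₂ F x₀ u₁ u₂ 0 t₁ x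

/-- Class `K∞` comparison functions. -/
def ClassKInfty (θ : ℝ → ℝ) : Prop :=
  ContinuousOn θ (Set.Ici 0) ∧ StrictMonoOn θ (Set.Ici 0) ∧ θ 0 = 0 ∧
  (∀ s : ℝ, 0 ≤ s → 0 ≤ θ s) ∧ Filter.Tendsto θ Filter.atTop Filter.atTop

/-- Class `KL` comparison functions. -/
def ClassKL (β : ℝ → ℝ → ℝ) : Prop :=
  (∀ s t : ℝ, 0 ≤ s → 0 ≤ t → 0 ≤ β s t) ∧
  (∀ t : ℝ, 0 ≤ t → ContinuousOn (fun s => β s t) (Set.Ici 0) ∧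
      StrictMonoOn (fun s => β s t) (Set.Ici 0) ∧ β 0 t = 0) ∧
  (∀ s : ℝ, 0 < s → StrictAntiOn (fun t => β s t) (Set.Ici 0) ∧
      Filter.Tendsto (fun t => β s t) Filter.atTop (nhds 0))

open scoped Topology NNReal ENNReal BoundedContinuousFunction

/-- Postcomposition with a Lipschitz map preserves absolute continuity. -/
lemma AbsolutelyContinuousOnInterval.lipschitzOnWith_comp {f φ : ℝ → ℝ} {a b : ℝ} {K : ℝ≥0}
    (hf : AbsolutelyContinuousOnInterval f a b) (hφ : LipschitzOnWith K φ (f '' uIcc a b)) :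
    AbsolutelyContinuousOnInterval (fun x => φ (f x)) a b := by
  rw [absolutelyContinuousOnInterval_iff] at hf ⊢
  intro ε hε
  obtain ⟨δ, hδ, h⟩ := hf (ε / (K + 1)) (by positivity)
  refine ⟨δ, hδ, fun E hE hlt => ?_⟩
  have h1 := h E hE hlt
  have h2 : ∑ i ∈ Finset.range E.1, dist (φ (f (E.2 i).1)) (φ (f (E.2 i).2)) ≤
      ∑ i ∈ Finset.range E.1, (K + 1 : ℝ) * dist (f (E.2 i).1) (f (E.2 i).2) := by
    refine Finset.sum_le_sum fun i hi => ?_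
    have hm := hE.1 i hi
    refine (hφ.dist_le_mul _ (mem_image_of_mem _ hm.1) _ (mem_image_of_mem _ hm.2)).trans ?_
    gcongr
    linarith
  rw [← Finset.mul_sum] at h2
  rw [lt_div_iff₀ (by positivity)] at h1
  linarith

/-- For the primitive `G` of an integrable function `k`, the function `exp (μ G) / μ` is a
primitive of `k exp (μ G)`. -/
lemma integral_mul_exp_primitive {k : ℝ → ℝ} {t : ℝ} (ht : 0 ≤ t)
    (hk : IntegrableOn k (Ioo 0 t)) {μ : ℝ} (hμ : 0 < μ) :
    IntegrableOn (fun s => k s * Real.exp (μ * ∫ r in Ioo 0 s, k r)) (Ioo 0 t) ∧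
    ∫ s in Ioo 0 t, k s * Real.exp (μ * ∫ r in Ioo 0 s, k r) =
      (Real.exp (μ * ∫ r in Ioo 0 t, k r) - 1) / μ := by
  have hki : IntervalIntegrable k volume 0 t := by
    rwa [intervalIntegrable_iff_integrableOn_Ioo_of_le ht]
  have hG : ∀ s, 0 ≤ s → ∫ r in Ioo 0 s, k r = ∫ r in (0 : ℝ)..s, k r := fun s hs => by
    rw [intervalIntegral.integral_of_le hs, integral_Ioc_eq_integral_Ioo]
  set G : ℝ → ℝ := fun s => ∫ r in (0 : ℝ)..s, k r with hGdef
  have hGac : AbsolutelyContinuousOnInterval G 0 t :=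
    hki.absolutelyContinuousOnInterval_intervalIntegral (by simp)
  have hlip : ∃ K : ℝ≥0, LipschitzOnWith K (fun y => Real.exp (μ * y)) (G '' uIcc 0 t) := by
    obtain ⟨C, hC⟩ := hGac.exists_bound
    have hcd : ContDiff ℝ 1 (fun y : ℝ => Real.exp (μ * y)) := by fun_prop
    obtain ⟨K, hK⟩ := (hcd.contDiffOn (s := Icc (-C) C)).exists_lipschitzOnWith
      one_ne_zero (convex_Icc _ _) isCompact_Icc
    refine ⟨K, hK.mono ?_⟩
    rintro _ ⟨x, hx, rfl⟩
    exact abs_le.1 (hC x hx)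
  obtain ⟨K, hK⟩ := hlip
  have hE := hGac.lipschitzOnWith_comp hK
  have hder : ∀ᵐ x, x ∈ uIcc 0 t →
      deriv (fun y => Real.exp (μ * G y)) x = μ * (k x * Real.exp (μ * G x)) := by
    filter_upwards [hki.ae_hasDerivAt_integral] with x hx hx2
    have := ((hx hx2 0 (by simp)).const_mul μ).exp
    rw [this.deriv]
    simp only [hGdef]
    ring
  have hint : IntervalIntegrable (fun s => k s * Real.exp (μ * G s)) volume 0 t :=
    hki.mul_continuousOn hE.continuousOn
  have heq : EqOn (fun s => k s * Real.exp (μ * ∫ r in Ioo 0 s, k r))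
      (fun s => k s * Real.exp (μ * G s)) (Ioo 0 t) := fun s hs => by
    simp only [hG s hs.1.le, hGdef]
  constructor
  · rw [integrableOn_congr_fun heq measurableSet_Ioo]
    rwa [intervalIntegrable_iff_integrableOn_Ioo_of_le ht] at hint
  · rw [setIntegral_congr_fun measurableSet_Ioo heq, hG t ht, ← integral_Ioc_eq_integral_Ioo,
      ← intervalIntegral.integral_of_le ht, eq_div_iff hμ.ne', mul_comm,
      ← intervalIntegral.integral_const_mul]
    have := hE.integral_deriv_eq_sub
    rw [intervalIntegral.integral_congr_ae (g := fun x => μ * (k x * Real.exp (μ * G x)))] at this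
    · rw [this]; simp [hGdef]
    · filter_upwards [hder] with x hx hx2
      exact hx (uIoc_subset_uIcc hx2)

lemma continuousOn_setIntegral_Ioo {k : ℝ → ℝ} {t : ℝ} (hk : IntegrableOn k (Ioo 0 t)) :
    ContinuousOn (fun s => ∫ r in Ioo 0 s, k r) (Icc 0 t) := by
  rcases lt_or_ge t 0 with h | ht
  · simp [Icc_eq_empty (not_le.2 h)]
  have hki : IntervalIntegrable k volume 0 t := by
    rwa [intervalIntegrable_iff_integrableOn_Ioo_of_le ht]
  have := (hki.absolutelyContinuousOnInterval_intervalIntegral (c := 0) (by simp)).continuousOn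
  rw [uIcc_of_le ht] at this
  refine this.congr fun s hs => ?_
  simp only
  rw [intervalIntegral.integral_of_le hs.1, integral_Ioc_eq_integral_Ioo]

/-- An `L^p`-convolution bound for a function dominated by an exponential of the primitive. -/
lemma rpow_integral_le_of_le_exp {k z : ℝ → ℝ} {t W l p : ℝ} (hp : 1 ≤ p) (ht : 0 ≤ t)
    (hk : IntegrableOn k (Ioo 0 t)) (hk0 : ∀ s, 0 ≤ k s) (hl : 0 < l) (hW : 0 ≤ W)
    (hz0 : ∀ s ∈ Ioo 0 t, 0 ≤ z s)
    (hz : ∀ s ∈ Ioo 0 t, z s ≤ W * Real.exp (l * ∫ r in Ioo 0 s, k r)) :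
    (∫ s in Ioo 0 t, z s ^ p * k s) ^ (1 / p) ≤
      W * Real.exp (l * ∫ r in Ioo 0 t, k r) / (p * l) ^ (1 / p) := by
  have hp0 : 0 < p := by linarith
  obtain ⟨hi, he⟩ := integral_mul_exp_primitive ht hk (mul_pos hp0 hl)
  have key : ∫ s in Ioo 0 t, z s ^ p * k s ≤
      W ^ p * (Real.exp (p * l * ∫ r in Ioo 0 t, k r) / (p * l)) := by
    calc ∫ s in Ioo 0 t, z s ^ p * k s
        ≤ ∫ s in Ioo 0 t, W ^ p * (k s * Real.exp (p * l * ∫ r in Ioo 0 s, k r)) := by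
          refine integral_mono_of_nonneg ?_ (hi.const_mul _) ?_
          · filter_upwards [ae_restrict_mem measurableSet_Ioo] with s hs
            exact mul_nonneg (Real.rpow_nonneg (hz0 s hs) _) (hk0 s)
          · filter_upwards [ae_restrict_mem measurableSet_Ioo] with s hs
            have h1 := Real.rpow_le_rpow (hz0 s hs) (hz s hs) hp0.le
            rw [Real.mul_rpow hW (Real.exp_pos _).le, ← Real.exp_mul] at h1
            calc z s ^ p * k s ≤ _ := mul_le_mul_of_nonneg_right h1 (hk0 s)
              _ = _ := by rw [show p * l * ∫ r in Ioo 0 s, k r = (l * ∫ r in Ioo 0 s, k r) * p by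
                            ring]; ring
      _ = W ^ p * ((Real.exp (p * l * ∫ r in Ioo 0 t, k r) - 1) / (p * l)) := by
          rw [integral_const_mul, he]
      _ ≤ _ := by gcongr; linarith
  have h0 : 0 ≤ ∫ s in Ioo 0 t, z s ^ p * k s :=
    setIntegral_nonneg measurableSet_Ioo
      fun s hs => mul_nonneg (Real.rpow_nonneg (hz0 s hs) _) (hk0 s)
  refine (Real.rpow_le_rpow h0 key (by positivity)).trans_eq ?_
  rw [Real.mul_rpow (by positivity) (by positivity), Real.div_rpow (by positivity) (by positivity),
    ← Real.rpow_mul hW, mul_one_div_cancel hp0.ne', Real.rpow_one, ← Real.exp_mul, mul_div_assoc]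
  congr 3
  field_simp

/-- The growth rate absorbing an `L^p`-convolution term with constant `c`. -/
noncomputable def growthRate (c p : ℝ) : ℝ := (2 * c) ^ p / p

lemma growthRate_pos {c p : ℝ} (hc : 0 < c) (hp : 1 ≤ p) : 0 < growthRate c p := by
  unfold growthRate; positivity

lemma mul_growthRate_rpow {c p : ℝ} (hc : 0 < c) (hp : 1 ≤ p) :
    (p * growthRate c p) ^ (1 / p) = 2 * c := by
  have hp0 : 0 < p := by linarith
  unfold growthRate
  rw [mul_div_cancel₀ _ hp0.ne', ← Real.rpow_mul (by positivity), mul_one_div_cancel hp0.ne',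
    Real.rpow_one]

/-- A Grönwall inequality for `L^p`-convolution bounds. -/
lemma gronwall_rpow {k z : ℝ → ℝ} {t a c p : ℝ} (hp : 1 ≤ p) (ht : 0 ≤ t)
    (hk : IntegrableOn k (Ioo 0 t)) (hk0 : ∀ s, 0 ≤ k s) (hc : 0 < c)
    (hzc : ContinuousOn z (Icc 0 t)) (hz0 : ∀ s, 0 ≤ z s)
    (hz : ∀ r ∈ Icc 0 t, z r ≤ a + c * (∫ s in Ioo 0 r, z s ^ p * k s) ^ (1 / p)) :
    z t ≤ 2 * a * Real.exp (growthRate c p * ∫ s in Ioo 0 t, k s) := by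
  set l := growthRate c p
  have hl : 0 < l := growthRate_pos hc hp
  set G : ℝ → ℝ := fun s => ∫ r in Ioo 0 s, k r with hG
  have hGc : ContinuousOn G (Icc 0 t) := continuousOn_setIntegral_Ioo hk
  have hGn : ∀ s, 0 ≤ G s := fun s => integral_nonneg hk0
  obtain ⟨r, hr, hmax⟩ := isCompact_Icc.exists_isMaxOn (nonempty_Icc.2 ht)
    (f := fun s => z s * Real.exp (-(l * G s))) (by fun_prop)
  set W := z r * Real.exp (-(l * G r)) with hW
  have hW0 : 0 ≤ W := mul_nonneg (hz0 r) (Real.exp_pos _).le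
  have hle : ∀ s ∈ Icc 0 t, z s ≤ W * Real.exp (l * G s) := fun s hs => by
    have : z s * Real.exp (-(l * G s)) ≤ W := hmax hs
    rwa [Real.exp_neg, ← div_eq_mul_inv, div_le_iff₀ (Real.exp_pos _)] at this
  have hzr : z r = W * Real.exp (l * G r) := by
    rw [hW, mul_assoc, ← Real.exp_add]; simp
  have h1 := rpow_integral_le_of_le_exp hp hr.1 (hk.mono_set (Ioo_subset_Ioo_right hr.2)) hk0 hl
    hW0 (fun s _ => hz0 s) (fun s hs => hle s ⟨hs.1.le, hs.2.le.trans hr.2⟩)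
  rw [mul_growthRate_rpow hc hp] at h1
  have h2 := hz r hr
  have h3 : c * (∫ s in Ioo 0 r, z s ^ p * k s) ^ (1 / p) ≤ z r / 2 := by
    rw [hzr]
    calc _ ≤ c * (W * Real.exp (l * G r) / (2 * c)) := by gcongr
      _ = _ := by field_simp
  have hWa : W ≤ 2 * a := by
    refine le_trans ?_ (show z r ≤ 2 * a by linarith)
    rw [hW]
    exact mul_le_of_le_one_right (hz0 r) (Real.exp_le_one_iff.2 (by have := hGn r; nlinarith))
  exact (hle t ⟨ht, le_rfl⟩).trans (by gcongr)

lemma memLp_ofReal_iff {α V : Type*} [MeasurableSpace α] {μ : Measure α} [NormedAddCommGroup V]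
    {u : α → V} {p : ℝ} (hp : 1 ≤ p) :
    MemLp u (ENNReal.ofReal p) μ ↔
      AEStronglyMeasurable u μ ∧ Integrable (fun s => ‖u s‖ ^ p) μ := by
  have hp0 : 0 < p := by linarith
  have h : ∀ hu : AEStronglyMeasurable u μ,
      Integrable (fun s => ‖u s‖ ^ p) μ ↔ MemLp u (ENNReal.ofReal p) μ := fun hu => by
    rw [← integrable_norm_rpow_iff hu (by simpa using hp0) ENNReal.ofReal_ne_top,
      ENNReal.toReal_ofReal hp0.le]
  exact ⟨fun hu => ⟨hu.1, (h hu.1).2 hu⟩, fun hu => (h hu.1).1 hu.2⟩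

lemma toReal_eLpNorm_ofReal {α V : Type*} [MeasurableSpace α] {μ : Measure α}
    [NormedAddCommGroup V] {u : α → V} {p : ℝ} (hp : 1 ≤ p) (hu : MemLp u (ENNReal.ofReal p) μ) :
    (eLpNorm u (ENNReal.ofReal p) μ).toReal = (∫ s, ‖u s‖ ^ p ∂μ) ^ (1 / p) := by
  have hp0 : 0 < p := by linarith
  rw [hu.eLpNorm_eq_integral_rpow_norm (by simpa using hp0) ENNReal.ofReal_ne_top,
    ENNReal.toReal_ofReal hp0.le, ENNReal.toReal_ofReal (by positivity), one_div]

/-- Translation is continuous in `L^p`. -/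
lemma tendsto_integral_translate_sub {V : Type*} [NormedAddCommGroup V] {v : ℝ → V} {p : ℝ}
    (hp : 1 ≤ p) (hv : MemLp v (ENNReal.ofReal p) volume) :
    Tendsto (fun h : ℝ => (∫ s, ‖v (s + h) - v s‖ ^ p) ^ (1 / p)) (𝓝 0) (𝓝 0) := by
  have : Fact (1 ≤ ENNReal.ofReal p) := ⟨by simpa using hp⟩
  have : Fact (ENNReal.ofReal p ≠ ∞) := ⟨ENNReal.ofReal_ne_top⟩
  have hshift : ∀ h : ℝ, MemLp (fun s => v (s + h)) (ENNReal.ofReal p) volume := fun h =>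
    hv.comp_measurePreserving (measurePreserving_add_right volume h)
  have hc : Continuous fun h : ℝ => DomAddAct.mk h +ᵥ hv.toLp v :=
    (DomAddAct.continuous_mk (M := ℝ)).vadd continuous_const
  have h1 : Tendsto (fun h : ℝ => ‖(DomAddAct.mk h +ᵥ hv.toLp v) - hv.toLp v‖) (𝓝 0) (𝓝 0) := by
    have := (hc.sub continuous_const).norm.tendsto (0 : ℝ) (f := fun h : ℝ =>
      ‖(DomAddAct.mk h +ᵥ hv.toLp v) - hv.toLp v‖)
    simpa using this
  refine h1.congr fun h => ?_
  have h2 : (DomAddAct.mk h +ᵥ hv.toLp v) = (hshift h).toLp _ := by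
    rw [DomAddAct.mk_vadd_toLp]
    congr 1
    ext s
    simp [add_comm]
  rw [h2, ← MemLp.toLp_sub, Lp.norm_toLp, toReal_eLpNorm_ofReal hp ((hshift h).sub hv)]
  rfl

section Convolution

variable {X Xm U : Type*} [NormedAddCommGroup X] [NormedSpace ℝ X]
  [NormedAddCommGroup Xm] [NormedSpace ℝ Xm] [NormedAddCommGroup U] [NormedSpace ℝ U]
  {T : C0Semigroup X} {E : Extrapolation Xm T} {ω p C : ℝ} {B : U →L[ℝ] Xm}

/-- The bound on the input map in weighted form. -/
def IsWeightedAdmissible (E : Extrapolation Xm T) (ω p : ℝ) (B : U →L[ℝ] Xm) (C : ℝ) : Prop :=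
  ∀ t : ℝ, 0 ≤ t → ∀ u : ℝ → U, MemLp u (ENNReal.ofReal p) (volume.restrict (Ioo 0 t)) →
    IntegrableOn (fun s => E.Tm (t - s) (B (u s))) (Ioo 0 t) ∧
    ∃ y : X, E.ι y = (∫ s in Ioo 0 t, E.Tm (t - s) (B (u s))) ∧
      Real.exp (ω * t / 2) * ‖y‖ ≤
        C * (∫ s in Ioo 0 t, (Real.exp (ω * s / 2) * ‖u s‖) ^ p) ^ (1 / p)

lemma memLp_exp_smul {t : ℝ} {u : ℝ → U} {q : ℝ≥0∞}
    (hu : MemLp u q (volume.restrict (Ioo 0 t))) :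
    MemLp (fun s => Real.exp (ω * s / 2) • u s) q (volume.restrict (Ioo 0 t)) := by
  refine hu.of_le_mul (c := Real.exp (|ω| * t / 2)) ?_ ?_
  · exact AEStronglyMeasurable.smul (by fun_prop) hu.1
  · filter_upwards [ae_restrict_mem measurableSet_Ioo] with s hs
    rw [norm_smul, Real.norm_eq_abs, Real.abs_exp]
    have h1 : ω * s ≤ |ω| * s := mul_le_mul_of_nonneg_right (le_abs_self ω) hs.1.le
    have h2 : |ω| * s ≤ |ω| * t := mul_le_mul_of_nonneg_left hs.2.le (abs_nonneg ω)
    have h3 := h1.trans h2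
    gcongr

lemma IsLpAdmissibleFor.isWeightedAdmissible (hp : 1 ≤ p)
    (hB : IsLpAdmissibleFor (fun t => Real.exp (ω * t / 2) • E.Tm t) E.ι p B (fun _ => C)) :
    IsWeightedAdmissible E ω p B (max C 1) := by
  intro t ht u hu
  rcases ht.eq_or_lt with rfl | ht
  · have hp0 : 0 < p := by linarith
    simp only [Ioo_self, integrableOn_empty, Measure.restrict_empty, integral_zero_measure,
      true_and]
    exact ⟨0, by simp, by simp [Real.zero_rpow (inv_pos.2 hp0).ne']⟩
  · have hv := (memLp_ofReal_iff hp).1 (memLp_exp_smul (ω := ω) hu)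
    obtain ⟨hi, y, hy, hyn⟩ := hB t ht _ hv.1 hv.2
    have heq : ∀ s, (fun t => Real.exp (ω * t / 2) • E.Tm t) (t - s)
        (B (Real.exp (ω * s / 2) • u s)) =
        Real.exp (ω * t / 2) • E.Tm (t - s) (B (u s)) := fun s => by
      simp only [map_smul, smul_apply, smul_smul, ← Real.exp_add]
      congr 2
      ring
    simp only [heq] at hi hy
    refine ⟨?_, Real.exp (-(ω * t / 2)) • y, ?_, ?_⟩
    · have := hi.smul (Real.exp (-(ω * t / 2)))
      simp only [Pi.smul_def, smul_smul, ← Real.exp_add, neg_add_cancel, Real.exp_zero,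
        one_smul] at this
      exact this
    · rw [map_smul, hy, integral_smul, smul_smul, ← Real.exp_add, neg_add_cancel, Real.exp_zero,
        one_smul]
    · rw [norm_smul, Real.norm_eq_abs, Real.abs_exp, ← mul_assoc, ← Real.exp_add,
        add_neg_cancel, Real.exp_zero, one_mul]
      simp only [norm_smul, Real.norm_eq_abs, Real.abs_exp] at hyn
      refine hyn.trans ?_
      exact mul_le_mul_of_nonneg_right (le_max_left _ _)
        (Real.rpow_nonneg (integral_nonneg fun s => by positivity) _)

/-- The input map `t ↦ ι⁻¹ ∫₀ᵗ T₋₁(t-s) B u(s) ds`. -/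
noncomputable def Extrapolation.conv (E : Extrapolation Xm T) (B : U →L[ℝ] Xm) (u : ℝ → U)
    (t : ℝ) : X :=
  Function.invFun E.ι (∫ s in Ioo 0 t, E.Tm (t - s) (B (u s)))

lemma Extrapolation.conv_of_nonpos {u : ℝ → U} {t : ℝ} (ht : t ≤ 0) : E.conv B u t = 0 := by
  rw [Extrapolation.conv, Ioo_eq_empty (not_lt.2 ht), Measure.restrict_empty,
    integral_zero_measure]
  exact E.ι_injective (by rw [Function.invFun_eq ⟨0, map_zero _⟩, map_zero])

lemma Extrapolation.conv_max {u : ℝ → U} (t : ℝ) : E.conv B u (max t 0) = E.conv B u t := by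
  rcases le_total t 0 with h | h
  · rw [max_eq_right h, conv_of_nonpos le_rfl, conv_of_nonpos h]
  · rw [max_eq_left h]

namespace IsWeightedAdmissible

variable {t : ℝ} {u v : ℝ → U}

lemma integrableOn (hB : IsWeightedAdmissible E ω p B C) (ht : 0 ≤ t)
    (hu : MemLp u (ENNReal.ofReal p) (volume.restrict (Ioo 0 t))) :
    IntegrableOn (fun s => E.Tm (t - s) (B (u s))) (Ioo 0 t) := (hB t ht u hu).1

lemma ι_conv (hB : IsWeightedAdmissible E ω p B C) (ht : 0 ≤ t)
    (hu : MemLp u (ENNReal.ofReal p) (volume.restrict (Ioo 0 t))) :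
    E.ι (E.conv B u t) = ∫ s in Ioo 0 t, E.Tm (t - s) (B (u s)) := by
  obtain ⟨-, y, hy, -⟩ := hB t ht u hu
  exact Function.invFun_eq ⟨y, hy⟩

lemma exp_mul_norm_conv_le (hB : IsWeightedAdmissible E ω p B C) (ht : 0 ≤ t)
    (hu : MemLp u (ENNReal.ofReal p) (volume.restrict (Ioo 0 t))) :
    Real.exp (ω * t / 2) * ‖E.conv B u t‖ ≤
      C * (∫ s in Ioo 0 t, (Real.exp (ω * s / 2) * ‖u s‖) ^ p) ^ (1 / p) := by
  obtain ⟨-, y, hy, hn⟩ := hB t ht u hu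
  rwa [E.ι_injective ((hB.ι_conv ht hu).trans hy.symm)]

lemma norm_conv_le (hB : IsWeightedAdmissible E ω p B C) (hp : 1 ≤ p) (hω : 0 ≤ ω) (hC : 0 ≤ C)
    (ht : 0 ≤ t) (hu : MemLp u (ENNReal.ofReal p) (volume.restrict (Ioo 0 t))) :
    ‖E.conv B u t‖ ≤ C * (∫ s in Ioo 0 t, ‖u s‖ ^ p) ^ (1 / p) := by
  have hp0 : 0 < p := by linarith
  have hi := ((memLp_ofReal_iff hp).1 hu).2
  have h1 : ∫ s in Ioo 0 t, (Real.exp (ω * s / 2) * ‖u s‖) ^ p ≤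
      Real.exp (ω * t / 2) ^ p * ∫ s in Ioo 0 t, ‖u s‖ ^ p := by
    rw [← integral_const_mul]
    refine integral_mono_of_nonneg (ae_of_all _ fun s => by positivity) (hi.const_mul _) ?_
    filter_upwards [ae_restrict_mem measurableSet_Ioo] with s hs
    have := hs.2.le
    rw [Real.mul_rpow (by positivity) (by positivity)]
    gcongr
  have h2 := (hB.exp_mul_norm_conv_le ht hu).trans (mul_le_mul_of_nonneg_left
    (Real.rpow_le_rpow (integral_nonneg fun s => by positivity) h1 (by positivity)) hC)
  rw [Real.mul_rpow (by positivity) (integral_nonneg fun s => by positivity),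
    ← Real.rpow_mul (by positivity), mul_one_div_cancel hp0.ne', Real.rpow_one,
    mul_left_comm] at h2
  exact le_of_mul_le_mul_left h2 (Real.exp_pos _)

lemma conv_sub (hB : IsWeightedAdmissible E ω p B C) (ht : 0 ≤ t)
    (hu : MemLp u (ENNReal.ofReal p) (volume.restrict (Ioo 0 t)))
    (hv : MemLp v (ENNReal.ofReal p) (volume.restrict (Ioo 0 t))) :
    E.conv B u t - E.conv B v t = E.conv B (fun s => u s - v s) t := by
  apply E.ι_injective
  rw [map_sub, hB.ι_conv ht hu, hB.ι_conv ht hv, hB.ι_conv (u := fun s => u s - v s) ht (hu.sub hv),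
    ← integral_sub (hB.integrableOn ht hu) (hB.integrableOn ht hv)]
  simp

lemma conv_add_time [CompleteSpace Xm] (hB : IsWeightedAdmissible E ω p B C) {h : ℝ} (ht : 0 ≤ t)
    (hh : 0 ≤ h) (hu : MemLp u (ENNReal.ofReal p) (volume.restrict (Ioo 0 (t + h)))) :
    E.conv B u (t + h) = T t (E.conv B u h) + E.conv B (fun s => u (s + h)) t := by
  have hu1 : MemLp u (ENNReal.ofReal p) (volume.restrict (Ioo 0 h)) :=
    hu.mono_measure (Measure.restrict_mono (Ioo_subset_Ioo_right (by linarith)) le_rfl)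
  have hpre : (fun s => s + h) ⁻¹' Ioo h (t + h) = Ioo 0 t := by
    ext s; simp
  have hmp : MeasurePreserving (fun s : ℝ => s + h) (volume.restrict (Ioo 0 t))
      (volume.restrict (Ioo h (t + h))) := by
    rw [← hpre]
    exact (measurePreserving_add_right volume h).restrict_preimage measurableSet_Ioo
  have hu2 : MemLp (fun s => u (s + h)) (ENNReal.ofReal p) (volume.restrict (Ioo 0 t)) :=
    (hu.mono_measure (Measure.restrict_mono (Ioo_subset_Ioo_left hh) le_rfl)).comp_measurePreserving
      hmp
  have hth : 0 ≤ t + h := add_nonneg ht hh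
  have hI := hB.integrableOn hth hu
  apply E.ι_injective
  rw [map_add, ← E.compat t ht, hB.ι_conv hth hu, hB.ι_conv hh hu1, hB.ι_conv ht hu2]
  have hsplit : ∫ s in Ioo 0 (t + h), E.Tm (t + h - s) (B (u s)) =
      (∫ s in Ioo 0 h, E.Tm (t + h - s) (B (u s))) +
        ∫ s in Ioo h (t + h), E.Tm (t + h - s) (B (u s)) := by
    simp only [← integral_Ioc_eq_integral_Ioo]
    rw [← Ioc_union_Ioc_eq_Ioc hh (show h ≤ t + h by linarith)]
    rw [← integrableOn_Ioc_iff_integrableOn_Ioo] at hI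
    exact setIntegral_union (Ioc_disjoint_Ioc_of_le le_rfl) measurableSet_Ioc
      (hI.mono_set (Ioc_subset_Ioc_right (by linarith)))
      (hI.mono_set (Ioc_subset_Ioc_left hh))
  rw [hsplit, ← ContinuousLinearMap.integral_comp_comm _ (hB.integrableOn hh hu1)]
  congr 1
  · refine setIntegral_congr_fun measurableSet_Ioo fun s hs => ?_
    have := E.Tm.map_add' t (h - s) ht (by linarith [hs.2])
    rw [add_sub_assoc]
    exact congrArg (fun L => L (B (u s))) this
  · rw [← hpre, ← (measurePreserving_add_right volume h).setIntegral_preimage_emb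
      (measurableEmbedding_addRight h) (fun s => E.Tm (t + h - s) (B (u s)))]
    simp

end IsWeightedAdmissible

end Convolution

lemma continuous_comp_max_of_norm_add_sub_le {V : Type*} [NormedAddCommGroup V] {f : ℝ → V}
    {δ : ℝ → ℝ} (hδ : Tendsto δ (𝓝[≥] 0) (𝓝 0))
    (hf : ∀ t h, 0 ≤ t → 0 ≤ h → ‖f (t + h) - f t‖ ≤ δ h) :
    Continuous fun t => f (max t 0) := by
  have key : ∀ ε > 0, ∃ η > 0, ∀ a b : ℝ, a ≤ b → b - a < η →
      dist (f (max b 0)) (f (max a 0)) < ε := by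
    intro ε hε
    obtain ⟨η, hη, h⟩ := Metric.tendsto_nhdsWithin_nhds.1 hδ ε hε
    refine ⟨η, hη, fun a b hab hlt => ?_⟩
    have h0 : 0 ≤ max b 0 - max a 0 := sub_nonneg.2 (max_le_max_right 0 hab)
    have h1 : max b 0 - max a 0 ≤ b - a := by
      have := abs_max_sub_max_le_abs b a 0
      rwa [abs_of_nonneg h0, abs_of_nonneg (sub_nonneg.2 hab)] at this
    have h2 := h (x := max b 0 - max a 0) h0 (by
      rw [Real.dist_eq, sub_zero, abs_of_nonneg h0]; linarith)
    have h3 := hf (max a 0) (max b 0 - max a 0) (le_max_right _ _) h0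
    rw [add_sub_cancel, ← dist_eq_norm] at h3
    rw [Real.dist_eq, sub_zero] at h2
    exact h3.trans_lt ((le_abs_self _).trans_lt h2)
  refine Metric.continuous_iff.2 fun b ε hε => ?_
  obtain ⟨η, hη, h⟩ := key ε hε
  refine ⟨η, hη, fun a ha => ?_⟩
  rw [Real.dist_eq] at ha
  rcases le_total a b with hab | hab
  · rw [dist_comm]
    exact h a b hab (by rw [abs_sub_comm] at ha; exact (le_abs_self _).trans_lt ha)
  · exact h b a hab ((le_abs_self _).trans_lt ha)

lemma continuous_setIntegral_Ioo {k : ℝ → ℝ} (hk : IntegrableOn k (Ioi 0)) :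
    Continuous fun t => ∫ r in Ioo 0 t, k r := by
  have h1 : Integrable ((Ioi 0).indicator k) := (integrable_indicator_iff measurableSet_Ioi).2 hk
  have h2 : (fun t => ∫ r in Ioo 0 t, k r) =
      fun t => ∫ r in (0 : ℝ)..max t 0, (Ioi 0).indicator k r := by
    ext t
    rw [intervalIntegral.integral_of_le (le_max_right _ _), integral_Ioc_eq_integral_Ioo]
    rcases le_total t 0 with h | h
    · simp [Ioo_eq_empty (not_lt.2 h), max_eq_right h]
    · rw [max_eq_left h]
      exact setIntegral_congr_fun measurableSet_Ioo fun s hs =>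
        (indicator_of_mem (show s ∈ Ioi 0 from hs.1) k).symm
  rw [h2]
  exact (intervalIntegral.continuous_primitive (fun a b => h1.intervalIntegrable) 0).comp
    (by fun_prop)

lemma rpow_integral_le_const_mul {g z w : ℝ → ℝ} {t c p : ℝ} (hp : 1 ≤ p) (hc : 0 ≤ c)
    (hz : ContinuousOn z (Icc 0 t)) (hz0 : ∀ s, 0 ≤ z s) (hw0 : ∀ s, 0 ≤ w s)
    (hw : IntegrableOn (fun s => w s ^ p) (Ioo 0 t))
    (hg0 : ∀ s, 0 ≤ g s) (hg : ∀ s ∈ Ioo 0 t, g s ≤ c * (z s * w s)) :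
    (∫ s in Ioo 0 t, g s ^ p) ^ (1 / p) ≤ c * (∫ s in Ioo 0 t, z s ^ p * w s ^ p) ^ (1 / p) := by
  have hp0 : 0 < p := by linarith
  have hi : IntegrableOn (fun s => z s ^ p * w s ^ p) (Ioo 0 t) := by
    rw [← integrableOn_Icc_iff_integrableOn_Ioo] at hw ⊢
    exact hw.continuousOn_mul (hz.rpow_const fun _ _ => Or.inr hp0.le) isCompact_Icc
  have h1 : ∫ s in Ioo 0 t, g s ^ p ≤ c ^ p * ∫ s in Ioo 0 t, z s ^ p * w s ^ p := by
    rw [← integral_const_mul]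
    refine integral_mono_of_nonneg (ae_of_all _ fun s => Real.rpow_nonneg (hg0 s) p)
      (hi.const_mul _) ?_
    filter_upwards [ae_restrict_mem measurableSet_Ioo] with s hs
    rw [← Real.mul_rpow (hz0 s) (hw0 s), ← Real.mul_rpow hc (mul_nonneg (hz0 s) (hw0 s))]
    exact Real.rpow_le_rpow (hg0 s) (hg s hs) hp0.le
  have h0 : 0 ≤ ∫ s in Ioo 0 t, z s ^ p * w s ^ p := integral_nonneg fun s =>
    mul_nonneg (Real.rpow_nonneg (hz0 s) p) (Real.rpow_nonneg (hw0 s) p)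
  refine (Real.rpow_le_rpow (integral_nonneg fun s => Real.rpow_nonneg (hg0 s) p) h1
    (by positivity)).trans_eq ?_
  rw [Real.mul_rpow (by positivity) h0, ← Real.rpow_mul hc, mul_one_div_cancel hp0.ne',
    Real.rpow_one]

lemma MeasureTheory.MemLp.Ioo_of_Ioi {V : Type*} [NormedAddCommGroup V] {u : ℝ → V} {q : ℝ≥0∞}
    (hu : MemLp u q (volume.restrict (Ioi 0))) (t : ℝ) : MemLp u q (volume.restrict (Ioo 0 t)) :=
  hu.mono_measure (Measure.restrict_mono Ioo_subset_Ioi_self le_rfl)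

section Convolution

variable {X Xm U : Type*} [NormedAddCommGroup X] [NormedSpace ℝ X]
  [NormedAddCommGroup Xm] [NormedSpace ℝ Xm] [NormedAddCommGroup U] [NormedSpace ℝ U]
  {T : C0Semigroup X} {E : Extrapolation Xm T} {ω p C : ℝ} {B : U →L[ℝ] Xm}

lemma Extrapolation.conv_congr {u v : ℝ → U} {t : ℝ} (h : EqOn u v (Ioo 0 t)) :
    E.conv B u t = E.conv B v t := by
  unfold Extrapolation.conv
  congr 1
  exact setIntegral_congr_fun measurableSet_Ioo fun s hs => by simp only [h hs]

namespace IsWeightedAdmissible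

variable {u : ℝ → U}

lemma norm_conv_le_of_memLp_Ioi (hB : IsWeightedAdmissible E ω p B C) (hp : 1 ≤ p) (hω : 0 ≤ ω)
    (hC : 0 ≤ C) (hu : MemLp u (ENNReal.ofReal p) (volume.restrict (Ioi 0))) (t : ℝ) :
    ‖E.conv B u t‖ ≤ C * (∫ s in Ioi 0, ‖u s‖ ^ p) ^ (1 / p) := by
  have h0 : ∀ S : Set ℝ, 0 ≤ ∫ s in S, ‖u s‖ ^ p := fun S =>
    integral_nonneg fun s => by positivity
  rw [← E.conv_max t]
  refine (hB.norm_conv_le hp hω hC (le_max_right _ _) (hu.Ioo_of_Ioi _)).trans ?_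
  have := setIntegral_mono_set ((memLp_ofReal_iff hp).1 hu).2
    (ae_of_all _ fun s => by positivity)
    (show Ioo 0 (max t 0) ⊆ Ioi 0 from Ioo_subset_Ioi_self).eventuallyLE
  have := h0 (Ioo 0 (max t 0))
  gcongr

lemma continuous_conv [CompleteSpace Xm] (hB : IsWeightedAdmissible E ω p B C) (hp : 1 ≤ p)
    (hω : 0 ≤ ω) (hC : 0 ≤ C) {M : ℝ} (hM : ∀ t, 0 ≤ t → ‖T t‖ ≤ M)
    (hu : MemLp u (ENNReal.ofReal p) (volume.restrict (Ioi 0))) :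
    Continuous (E.conv B u) := by
  have hp0 : 0 < p := by linarith
  have hM0 : 0 ≤ M := (norm_nonneg _).trans (hM 0 le_rfl)
  set v : ℝ → U := (Ioi 0).indicator u with hvdef
  have hv : MemLp v (ENNReal.ofReal p) volume :=
    (memLp_indicator_iff_restrict measurableSet_Ioi).2 hu
  have hvr : ∀ S : Set ℝ, MemLp v (ENNReal.ofReal p) (volume.restrict S) := fun S => hv.restrict S
  have hvt : ∀ h : ℝ, MemLp (fun s => v (s + h)) (ENNReal.ofReal p) volume := fun h =>
    hv.comp_measurePreserving (measurePreserving_add_right volume h)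
  have huv : E.conv B u = fun t => E.conv B v (max t 0) := by
    ext t
    rw [E.conv_max]
    exact Extrapolation.conv_congr fun s hs => (indicator_of_mem (show s ∈ Ioi 0 from hs.1) u).symm
  rw [huv]
  refine continuous_comp_max_of_norm_add_sub_le
    (δ := fun h => M * (C * (∫ s in Ioo 0 h, ‖v s‖ ^ p) ^ (1 / p)) +
      C * (∫ s, ‖v (s + h) - v s‖ ^ p) ^ (1 / p)) ?_ fun t h ht hh => ?_
  · have h1 : Tendsto (fun h : ℝ => ∫ s in Ioo 0 h, ‖v s‖ ^ p) (𝓝 0) (𝓝 0) := by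
      have := (continuous_setIntegral_Ioo
        ((memLp_ofReal_iff hp).1 hv).2.integrableOn).tendsto (0 : ℝ)
      simpa using this
    have h2 := (((h1.rpow_const (p := 1 / p) (Or.inr (by positivity))).const_mul C).const_mul
      M).add ((tendsto_integral_translate_sub hp hv).const_mul C)
    rw [Real.zero_rpow (by positivity)] at h2
    simp only [mul_zero, add_zero] at h2
    exact h2.mono_left nhdsWithin_le_nhds
  · rw [hB.conv_add_time ht hh (hvr _), add_sub_assoc,
      hB.conv_sub ht ((hvt h).restrict _) (hvr _)]
    refine (norm_add_le _ _).trans (add_le_add ?_ ?_)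
    · refine ((T t).le_opNorm _).trans ?_
      exact mul_le_mul (hM t ht) (hB.norm_conv_le hp hω hC hh (hvr _)) (norm_nonneg _) hM0
    · have hd : MemLp (fun s => v (s + h) - v s) (ENNReal.ofReal p) volume := (hvt h).sub hv
      refine (hB.norm_conv_le hp hω hC ht (hd.restrict _)).trans ?_
      have h1 := setIntegral_le_integral (s := Ioo 0 t) ((memLp_ofReal_iff hp).1 hd).2
        (ae_of_all _ fun s => by positivity)
      have h0 : 0 ≤ ∫ s in Ioo 0 t, ‖v (s + h) - v s‖ ^ p :=
        integral_nonneg fun s => by positivity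
      gcongr

end IsWeightedAdmissible

end Convolution

section RadialRetraction

variable {X : Type*} [NormedAddCommGroup X] [NormedSpace ℝ X] {R : ℝ}

/-- The radial retraction of a normed space onto the closed ball of radius `R`. -/
noncomputable def radialRetraction (R : ℝ) (x : X) : X := (R / max R ‖x‖) • x

lemma radialRetraction_of_norm_le (hR : 0 < R) {x : X} (hx : ‖x‖ ≤ R) :
    radialRetraction R x = x := by
  rw [radialRetraction, max_eq_left hx, div_self hR.ne', one_smul]

lemma norm_radialRetraction (hR : 0 < R) (x : X) :
    ‖radialRetraction R x‖ = R / max R ‖x‖ * ‖x‖ := by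
  have : 0 < max R ‖x‖ := lt_max_of_lt_left hR
  rw [radialRetraction, norm_smul, Real.norm_of_nonneg (by positivity)]

lemma norm_radialRetraction_le_norm (hR : 0 < R) (x : X) : ‖radialRetraction R x‖ ≤ ‖x‖ := by
  rw [norm_radialRetraction hR]
  exact mul_le_of_le_one_left (norm_nonneg _)
    (div_le_one_of_le₀ (le_max_left _ _) (hR.le.trans (le_max_left _ _)))

lemma norm_radialRetraction_le (hR : 0 < R) (x : X) : ‖radialRetraction R x‖ ≤ R := by
  have : 0 < max R ‖x‖ := lt_max_of_lt_left hR
  rw [norm_radialRetraction hR, div_mul_eq_mul_div, div_le_iff₀ this]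
  exact mul_le_mul_of_nonneg_left (le_max_right _ _) hR.le

lemma norm_radialRetraction_sub_le (hR : 0 < R) (x y : X) :
    ‖radialRetraction R x - radialRetraction R y‖ ≤ 2 * ‖x - y‖ := by
  have hx : 0 < max R ‖x‖ := lt_max_of_lt_left hR
  have hy : 0 < max R ‖y‖ := lt_max_of_lt_left hR
  have h : radialRetraction R x - radialRetraction R y =
      (R / max R ‖x‖) • (x - y) + (R / max R ‖x‖ - R / max R ‖y‖) • y := by
    rw [radialRetraction, radialRetraction, smul_sub, sub_smul]; abel
  have h1 : ‖(R / max R ‖x‖) • (x - y)‖ ≤ ‖x - y‖ := by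
    rw [norm_smul, Real.norm_of_nonneg (by positivity)]
    exact mul_le_of_le_one_left (norm_nonneg _) (div_le_one_of_le₀ (le_max_left _ _) hx.le)
  have h2 : ‖(R / max R ‖x‖ - R / max R ‖y‖) • y‖ ≤ ‖x - y‖ := by
    have h3 : |max R ‖y‖ - max R ‖x‖| ≤ ‖x - y‖ := by
      rw [max_comm R, max_comm R]
      refine (abs_max_sub_max_le_abs ‖y‖ ‖x‖ R).trans ?_
      rw [norm_sub_rev]
      exact abs_norm_sub_norm_le y x
    have h4 : R / max R ‖x‖ - R / max R ‖y‖ =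
        (R / max R ‖x‖) * ((max R ‖y‖ - max R ‖x‖) / max R ‖y‖) := by
      field_simp
    rw [norm_smul, h4, Real.norm_eq_abs, abs_mul, abs_div _ (max R ‖y‖), abs_of_pos hy,
      abs_of_pos (div_pos hR hx)]
    calc R / max R ‖x‖ * (|max R ‖y‖ - max R ‖x‖| / max R ‖y‖) * ‖y‖
        = (R / max R ‖x‖) * (‖y‖ / max R ‖y‖) * |max R ‖y‖ - max R ‖x‖| := by ring
      _ ≤ 1 * 1 * ‖x - y‖ := by
        gcongr
        · exact div_le_one_of_le₀ (le_max_left _ _) hx.le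
        · exact div_le_one_of_le₀ (le_max_right _ _) hy.le
      _ = ‖x - y‖ := by ring
  rw [h]
  linarith [norm_add_le ((R / max R ‖x‖) • (x - y)) ((R / max R ‖x‖ - R / max R ‖y‖) • y)]

lemma continuous_radialRetraction (hR : 0 < R) :
    Continuous (radialRetraction R : X → X) :=
  (LipschitzWith.of_dist_le_mul (K := 2) fun x y => by
    rw [dist_eq_norm, dist_eq_norm]; exact norm_radialRetraction_sub_le hR x y).continuous

variable {U₁ Xt : Type*} [NormedAddCommGroup U₁] [NormedSpace ℝ U₁]
  [NormedAddCommGroup Xt] [NormedSpace ℝ Xt] {F : X → U₁ → Xt} {m : ℝ}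

/-- Truncating the state argument makes the nonlinearity globally Lipschitz. -/
lemma StandingAssumptions.exists_lipschitz_radialRetraction (hF : StandingAssumptions m F)
    (hR : 0 < R) : ∃ L > 0, ∀ x y u,
      ‖F (radialRetraction R x) u - F (radialRetraction R y) u‖ ≤ L * ‖u‖ * ‖x - y‖ := by
  obtain ⟨L, hL, h⟩ := hF.lipschitz (Metric.closedBall 0 R) Metric.isBounded_closedBall
  refine ⟨L * 2, by positivity, fun x y u => ?_⟩
  refine (h _ (by simpa using norm_radialRetraction_le hR x) _
    (by simpa using norm_radialRetraction_le hR y) u).trans ?_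
  calc L * ‖u‖ * ‖radialRetraction R x - radialRetraction R y‖
      ≤ L * ‖u‖ * (2 * ‖x - y‖) := by gcongr; exact norm_radialRetraction_sub_le hR x y
    _ = _ := by ring

lemma StandingAssumptions.comp_radialRetraction (hF : StandingAssumptions m F) (hm : 0 ≤ m)
    (hR : 0 < R) : StandingAssumptions m (fun x u => F (radialRetraction R x) u) where
  norm_bound x u := (hF.norm_bound _ u).trans (by
    gcongr; exact norm_radialRetraction_le_norm hR x)
  lipschitz Xb _ := by
    obtain ⟨L, hL, h⟩ := hF.exists_lipschitz_radialRetraction hR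
    exact ⟨L, hL, fun x _ y _ u => h x y u⟩
  stronglyMeasurable_comp f g hf hg := hF.stronglyMeasurable_comp _ _
    ((continuous_radialRetraction hR).comp_stronglyMeasurable hf) hg

end RadialRetraction

section MildSolution

variable {X Xt U₁ U₂ Xm : Type*}
  [NormedAddCommGroup X] [NormedSpace ℝ X]
  [NormedAddCommGroup Xt] [NormedSpace ℝ Xt]
  [NormedAddCommGroup U₁] [NormedSpace ℝ U₁]
  [NormedAddCommGroup U₂] [NormedSpace ℝ U₂]
  [NormedAddCommGroup Xm] [NormedSpace ℝ Xm]
  {T : C0Semigroup X} {E : Extrapolation Xm T} {ω p q m C₁ C₂ : ℝ}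
  {B₁ : Xt →L[ℝ] Xm} {B₂ : U₂ →L[ℝ] Xm} {F : X → U₁ → Xt}
  {x₀ : X} {u₁ : ℝ → U₁} {u₂ : ℝ → U₂} {x y : ℝ → X}

lemma StandingAssumptions.memLp_comp (hF : StandingAssumptions m F) (hm : 0 ≤ m) {S : Set ℝ}
    (hS : S ⊆ Ioi 0) (hSm : MeasurableSet S) {r : ℝ≥0∞} (hu : MemLp u₁ r (volume.restrict (Ioi 0)))
    (hx : ContinuousOn x (Ici 0)) {R : ℝ} (hR : ∀ s ∈ S, ‖x s‖ ≤ R) :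
    MemLp (fun s => F (x s) (u₁ s)) r (volume.restrict S) := by
  have huS : MemLp u₁ r (volume.restrict S) := hu.mono_measure (Measure.restrict_mono hS le_rfl)
  refine huS.of_le_mul (c := m * R) ?_ ?_
  · have hxc : Continuous fun s => x (max s 0) :=
      hx.comp_continuous (by fun_prop) fun s => mem_Ici.2 (le_max_right _ _)
    refine ⟨fun s => F (x (max s 0)) (huS.1.mk u₁ s),
      hF.stronglyMeasurable_comp _ _ hxc.stronglyMeasurable huS.1.stronglyMeasurable_mk, ?_⟩
    filter_upwards [huS.1.ae_eq_mk, ae_restrict_mem hSm] with s hs hsS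
    rw [← hs, max_eq_left (le_of_lt (hS hsS))]
  · filter_upwards [ae_restrict_mem hSm] with s hs
    refine (hF.norm_bound _ _).trans ?_
    gcongr
    exact hR s hs

lemma exists_norm_le_of_continuousOn_Ici {Z : Type*} [NormedAddCommGroup Z] {z : ℝ → Z}
    (hz : ContinuousOn z (Ici 0)) (t : ℝ) : ∃ R, ∀ s ∈ Icc 0 t, ‖z s‖ ≤ R :=
  isCompact_Icc.exists_bound_of_continuousOn (hz.mono Icc_subset_Ici_self)

lemma StandingAssumptions.memLp_Ioo (hF : StandingAssumptions m F) (hm : 0 ≤ m) {r : ℝ≥0∞}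
    (hu : MemLp u₁ r (volume.restrict (Ioi 0))) (hx : ContinuousOn x (Ici 0)) (t : ℝ) :
    MemLp (fun s => F (x s) (u₁ s)) r (volume.restrict (Ioo 0 t)) := by
  obtain ⟨R, hR⟩ := exists_norm_le_of_continuousOn_Ici hx t
  exact hF.memLp_comp hm Ioo_subset_Ioi_self measurableSet_Ioo hu hx
    fun s hs => hR s (Ioo_subset_Icc_self hs)

/-- The mild solution equation, written in `X`. -/
def SolvesMildEquation (E : Extrapolation Xm T) (B₁ : Xt →L[ℝ] Xm) (B₂ : U₂ →L[ℝ] Xm)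
    (F : X → U₁ → Xt) (x₀ : X) (u₁ : ℝ → U₁) (u₂ : ℝ → U₂) (x : ℝ → X) : Prop :=
  ContinuousOn x (Ici 0) ∧ ∀ t, 0 ≤ t →
    x t = T t x₀ + E.conv B₁ (fun s => F (x s) (u₁ s)) t + E.conv B₂ u₂ t

lemma isGlobalMildSolution_iff (hB₁ : IsWeightedAdmissible E ω p B₁ C₁)
    (hB₂ : IsWeightedAdmissible E ω q B₂ C₂) (hF : StandingAssumptions m F) (hm : 0 ≤ m)
    (hu₁ : MemLp u₁ (ENNReal.ofReal p) (volume.restrict (Ioi 0)))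
    (hu₂ : MemLp u₂ (ENNReal.ofReal q) (volume.restrict (Ioi 0))) :
    IsGlobalMildSolution T E B₁ B₂ F x₀ u₁ u₂ x ↔
      SolvesMildEquation E B₁ B₂ F x₀ u₁ u₂ x := by
  refine and_congr_right fun hx => ?_
  have hi : ∀ t, 0 ≤ t →
      IntegrableOn (fun s => E.Tm (t - s) (B₁ (F (x s) (u₁ s)) + B₂ (u₂ s))) (Ioo 0 t) ∧
      E.ι (T t x₀) + ∫ s in Ioo 0 t, E.Tm (t - s) (B₁ (F (x s) (u₁ s)) + B₂ (u₂ s)) =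
        E.ι (T t x₀ + E.conv B₁ (fun s => F (x s) (u₁ s)) t + E.conv B₂ u₂ t) := by
    intro t ht
    have h1 := hB₁.integrableOn ht (hF.memLp_Ioo hm hu₁ hx t)
    have h2 := hB₂.integrableOn ht (hu₂.Ioo_of_Ioi t)
    simp only [map_add]
    refine ⟨h1.add h2, ?_⟩
    rw [integral_add h1 h2, hB₁.ι_conv ht (hF.memLp_Ioo hm hu₁ hx t),
      hB₂.ι_conv ht (hu₂.Ioo_of_Ioi t), add_assoc]
  constructor
  · intro h t ht
    have h1 := ((h (t + 1) (by linarith)).2 t ⟨ht, by linarith⟩).2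
    rw [sub_zero, (hi t ht).2] at h1
    exact E.ι_injective h1
  · intro h t₁ _
    refine ⟨hx.mono Icc_subset_Ici_self, fun t ht => ⟨(hi t ht.1).1, ?_⟩⟩
    rw [sub_zero, (hi t ht.1).2, ← h t ht.1]

lemma SolvesMildEquation.norm_le {M : ℝ} (hM : 0 ≤ M) (hω : 0 ≤ ω)
    (hT : ∀ t : ℝ, 0 ≤ t → ‖T t‖ ≤ M * Real.exp (-ω * t))
    (hp : 1 ≤ p) (hq : 1 ≤ q) (hC₁ : 0 < C₁) (hC₂ : 0 ≤ C₂)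
    (hB₁ : IsWeightedAdmissible E ω p B₁ C₁)
    (hB₂ : IsWeightedAdmissible E ω q B₂ C₂) (hF : StandingAssumptions m F) (hm : 0 < m)
    (hu₁ : MemLp u₁ (ENNReal.ofReal p) (volume.restrict (Ioi 0)))
    (hu₂ : MemLp u₂ (ENNReal.ofReal q) (volume.restrict (Ioi 0)))
    (hx : SolvesMildEquation E B₁ B₂ F x₀ u₁ u₂ x) {t : ℝ} (ht : 0 ≤ t) :
    ‖x t‖ ≤ 2 * (M * Real.exp (-(ω * t / 2)) * ‖x₀‖ +
      C₂ * (∫ s in Ioo 0 t, ‖u₂ s‖ ^ q) ^ (1 / q)) *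
      Real.exp (growthRate (C₁ * m) p * ∫ s in Ioo 0 t, ‖u₁ s‖ ^ p) := by
  set N := (∫ s in Ioo 0 t, ‖u₂ s‖ ^ q) ^ (1 / q) with hN
  have hzc : ContinuousOn (fun s => Real.exp (ω * s / 2) * ‖x s‖) (Icc 0 t) := by
    have : ContinuousOn x (Icc 0 t) := hx.1.mono Icc_subset_Ici_self
    fun_prop
  have hk : IntegrableOn (fun s => ‖u₁ s‖ ^ p) (Ioo 0 t) :=
    ((memLp_ofReal_iff hp).1 (hu₁.Ioo_of_Ioi t)).2
  have key := gronwall_rpow (k := fun s => ‖u₁ s‖ ^ p)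
    (z := fun s => Real.exp (ω * s / 2) * ‖x s‖) (a := M * ‖x₀‖ + Real.exp (ω * t / 2) * (C₂ * N))
    (c := C₁ * m) hp ht hk (fun s => by positivity) (by positivity) hzc (fun s => by positivity)
    (fun r hr => by
      have hf := hF.memLp_Ioo hm.le hu₁ hx.1 r
      have h1 : Real.exp (ω * r / 2) * ‖T r x₀‖ ≤ M * ‖x₀‖ := by
        calc Real.exp (ω * r / 2) * ‖T r x₀‖
            ≤ Real.exp (ω * r / 2) * (M * Real.exp (-ω * r) * ‖x₀‖) := by
              gcongr
              exact (T r).le_of_opNorm_le (hT r hr.1) x₀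
          _ = M * ‖x₀‖ * Real.exp (ω * r / 2 + -ω * r) := by rw [Real.exp_add]; ring
          _ ≤ M * ‖x₀‖ * 1 := by
              gcongr
              exact Real.exp_le_one_iff.2 (by nlinarith [mul_nonneg hω hr.1])
          _ = _ := mul_one _
      have h2 : Real.exp (ω * r / 2) * ‖E.conv B₁ (fun s => F (x s) (u₁ s)) r‖ ≤
          C₁ * m * (∫ s in Ioo 0 r, (Real.exp (ω * s / 2) * ‖x s‖) ^ p * ‖u₁ s‖ ^ p) ^ (1 / p) := by
        refine (hB₁.exp_mul_norm_conv_le hr.1 hf).trans ?_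
        rw [mul_assoc]
        refine mul_le_mul_of_nonneg_left ?_ hC₁.le
        refine rpow_integral_le_const_mul hp hm.le (hzc.mono (Icc_subset_Icc_right hr.2))
          (fun s => by positivity) (fun s => norm_nonneg _)
          (hk.mono_set (Ioo_subset_Ioo_right hr.2)) (fun s => by positivity) fun s _ => ?_
        calc Real.exp (ω * s / 2) * ‖F (x s) (u₁ s)‖
            ≤ Real.exp (ω * s / 2) * (m * ‖x s‖ * ‖u₁ s‖) := by
              gcongr; exact hF.norm_bound _ _
          _ = _ := by ring
      have h3 : Real.exp (ω * r / 2) * ‖E.conv B₂ u₂ r‖ ≤ Real.exp (ω * t / 2) * (C₂ * N) := by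
        have hrt := hr.2
        have h4 : (∫ s in Ioo 0 r, ‖u₂ s‖ ^ q) ^ (1 / q) ≤ N := by
          refine Real.rpow_le_rpow (integral_nonneg fun s => by positivity) ?_ (by positivity)
          exact setIntegral_mono_set ((memLp_ofReal_iff hq).1 (hu₂.Ioo_of_Ioi t)).2
            (ae_of_all _ fun s => by positivity) (Ioo_subset_Ioo_right hr.2).eventuallyLE
        gcongr
        exact (hB₂.norm_conv_le hq hω hC₂ hr.1 (hu₂.Ioo_of_Ioi r)).trans (by gcongr)
      rw [hx.2 r hr.1]
      calc _ ≤ Real.exp (ω * r / 2) * (‖T r x₀‖ + ‖E.conv B₁ (fun s => F (x s) (u₁ s)) r‖ +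
            ‖E.conv B₂ u₂ r‖) := by gcongr; exact norm_add₃_le
        _ ≤ _ := by linarith)
  rw [mul_comm, ← le_div_iff₀ (Real.exp_pos _), div_eq_mul_inv, ← Real.exp_neg] at key
  refine key.trans_eq ?_
  have he : Real.exp (ω * t / 2) * Real.exp (-(ω * t / 2)) = 1 := by
    rw [← Real.exp_add, add_neg_cancel, Real.exp_zero]
  linear_combination (2 * C₂ * N *
    Real.exp (growthRate (C₁ * m) p * ∫ s in Ioo 0 t, ‖u₁ s‖ ^ p)) * he

lemma SolvesMildEquation.eqOn (hω : 0 ≤ ω) (hp : 1 ≤ p) (hC₁ : 0 < C₁)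
    (hB₁ : IsWeightedAdmissible E ω p B₁ C₁) (hF : StandingAssumptions m F) (hm : 0 ≤ m)
    (hu₁ : MemLp u₁ (ENNReal.ofReal p) (volume.restrict (Ioi 0)))
    (hx : SolvesMildEquation E B₁ B₂ F x₀ u₁ u₂ x)
    (hy : SolvesMildEquation E B₁ B₂ F x₀ u₁ u₂ y) : EqOn x y (Ici 0) := by
  intro t ht
  obtain ⟨R, hR⟩ := exists_norm_le_of_continuousOn_Ici hx.1 t
  obtain ⟨R', hR'⟩ := exists_norm_le_of_continuousOn_Ici hy.1 t
  obtain ⟨L, hL, hlip⟩ := hF.lipschitz (Metric.closedBall 0 (max R R'))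
    Metric.isBounded_closedBall
  have hzc : ContinuousOn (fun s => ‖x s - y s‖) (Icc 0 t) :=
    ((hx.1.sub hy.1).norm).mono Icc_subset_Ici_self
  have hk : IntegrableOn (fun s => ‖u₁ s‖ ^ p) (Ioo 0 t) :=
    ((memLp_ofReal_iff hp).1 (hu₁.Ioo_of_Ioi t)).2
  have key := gronwall_rpow (k := fun s => ‖u₁ s‖ ^ p) (z := fun s => ‖x s - y s‖) (a := 0)
    (c := C₁ * L) hp ht hk (fun s => by positivity) (by positivity) hzc (fun s => norm_nonneg _)
    (fun r hr => by
      have hf := hF.memLp_Ioo hm hu₁ hx.1 r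
      have hg := hF.memLp_Ioo hm hu₁ hy.1 r
      rw [zero_add, hx.2 r hr.1, hy.2 r hr.1, add_sub_add_right_eq_sub, add_sub_add_left_eq_sub,
        hB₁.conv_sub hr.1 hf hg]
      refine (hB₁.norm_conv_le hp hω hC₁.le hr.1 (hf.sub hg)).trans ?_
      rw [mul_assoc]
      refine mul_le_mul_of_nonneg_left ?_ hC₁.le
      refine rpow_integral_le_const_mul hp hL.le (hzc.mono (Icc_subset_Icc_right hr.2))
          (fun s => norm_nonneg _) (fun s => norm_nonneg _)
          (hk.mono_set (Ioo_subset_Ioo_right hr.2)) (fun s => norm_nonneg _) fun s hs => ?_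
      have hs' : s ∈ Icc 0 t := ⟨hs.1.le, hs.2.le.trans hr.2⟩
      refine (hlip _ (by simpa using Or.inl (hR s hs')) _ (by simpa using Or.inr (hR' s hs'))
        _).trans_eq (by ring))
  simp only [mul_zero, zero_mul] at key
  exact sub_eq_zero.1 (norm_le_zero_iff.1 key)

lemma exists_solvesMildEquation_of_lipschitz [CompleteSpace X] [CompleteSpace Xm] {M : ℝ}
    (hω : 0 ≤ ω) (hT : ∀ t : ℝ, 0 ≤ t → ‖T t‖ ≤ M)
    (hp : 1 ≤ p) (hq : 1 ≤ q) (hC₁ : 0 < C₁) (hC₂ : 0 ≤ C₂)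
    (hB₁ : IsWeightedAdmissible E ω p B₁ C₁)
    (hB₂ : IsWeightedAdmissible E ω q B₂ C₂) (hF : StandingAssumptions m F) (hm : 0 ≤ m)
    {L : ℝ} (hL : 0 < L) (hlip : ∀ x y u, ‖F x u - F y u‖ ≤ L * ‖u‖ * ‖x - y‖)
    (x₀ : X) (hu₁ : MemLp u₁ (ENNReal.ofReal p) (volume.restrict (Ioi 0)))
    (hu₂ : MemLp u₂ (ENNReal.ofReal q) (volume.restrict (Ioi 0))) :
    ∃ x, SolvesMildEquation E B₁ B₂ F x₀ u₁ u₂ x := by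
  have hk := ((memLp_ofReal_iff hp).1 hu₁).2
  set G : ℝ → ℝ := fun t => ∫ s in Ioo 0 t, ‖u₁ s‖ ^ p with hG
  have hGc : Continuous G := continuous_setIntegral_Ioo hk
  have hG0 : ∀ t, 0 ≤ G t := fun t => integral_nonneg fun s => by positivity
  have hGle : ∀ t, G t ≤ ∫ s in Ioi 0, ‖u₁ s‖ ^ p := fun t =>
    setIntegral_mono_set hk (ae_of_all _ fun s => by positivity)
      (show Ioo 0 t ⊆ Ioi 0 from Ioo_subset_Ioi_self).eventuallyLE
  set l := growthRate (C₁ * L) p with hl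
  have hl0 : 0 < l := growthRate_pos (by positivity) hp
  set S : ℝ → X := fun t => T (max t 0) x₀
  have hSc : Continuous S := (T.continuousOn_apply' x₀).comp_continuous (by fun_prop)
    fun t => mem_Ici.2 (le_max_right _ _)
  have hSb : ∀ t, ‖S t‖ ≤ M * ‖x₀‖ := fun t => (T _).le_of_opNorm_le (hT _ (le_max_right _ _)) _
  set f : (ℝ →ᵇ X) → ℝ → Xt := fun y s => F (Real.exp (l * G s) • y s) (u₁ s) with hf
  have hfL : ∀ y, MemLp (f y) (ENNReal.ofReal p) (volume.restrict (Ioi 0)) := fun y => by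
    refine hF.memLp_comp hm Subset.rfl measurableSet_Ioi hu₁
      (x := fun s => Real.exp (l * G s) • y s) (by fun_prop)
      (R := Real.exp (l * ∫ s in Ioi 0, ‖u₁ s‖ ^ p) * ‖y‖) fun s _ => ?_
    rw [norm_smul, Real.norm_eq_abs, Real.abs_exp]
    have := hGle s
    gcongr
    exact y.norm_coe_le_norm s
  set P : (ℝ →ᵇ X) → ℝ → X := fun y t =>
    Real.exp (-(l * G t)) • (S t + E.conv B₁ (f y) t + E.conv B₂ u₂ t) with hP
  have hPc : ∀ y, Continuous (P y) := fun y => by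
    have h1 := hB₁.continuous_conv hp hω hC₁.le hT (hfL y)
    have h2 := hB₂.continuous_conv hq hω hC₂ hT hu₂
    fun_prop
  have hexp : ∀ t, Real.exp (-(l * G t)) ≤ 1 := fun t =>
    Real.exp_le_one_iff.2 (neg_nonpos.2 (mul_nonneg hl0.le (hG0 t)))
  have hPb : ∀ y t, ‖P y t‖ ≤ M * ‖x₀‖ + C₁ * (∫ s in Ioi 0, ‖f y s‖ ^ p) ^ (1 / p) +
      C₂ * (∫ s in Ioi 0, ‖u₂ s‖ ^ q) ^ (1 / q) := fun y t => by
    rw [hP, norm_smul, Real.norm_eq_abs, Real.abs_exp]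
    refine (mul_le_of_le_one_left (norm_nonneg _) (hexp t)).trans (norm_add₃_le.trans ?_)
    exact add_le_add (add_le_add (hSb t) (hB₁.norm_conv_le_of_memLp_Ioi hp hω hC₁.le (hfL y) t))
      (hB₂.norm_conv_le_of_memLp_Ioi hq hω hC₂ hu₂ t)
  set Φ : (ℝ →ᵇ X) → (ℝ →ᵇ X) := fun y =>
    BoundedContinuousFunction.ofNormedAddCommGroup (P y) (hPc y) _ (hPb y) with hΦ
  have hcontr : ContractingWith (1 / 2 : ℝ≥0) Φ := by
    refine ⟨by norm_num, LipschitzWith.of_dist_le_mul fun y z => ?_⟩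
    refine (BoundedContinuousFunction.dist_le (by positivity)).2 fun t => ?_
    change dist (P y t) (P z t) ≤ _
    rw [dist_eq_norm, hP]
    simp only
    rw [← smul_sub, add_sub_add_right_eq_sub, add_sub_add_left_eq_sub, norm_smul,
      Real.norm_eq_abs, Real.abs_exp]
    rcases le_total t 0 with ht | ht
    · rw [E.conv_of_nonpos ht, E.conv_of_nonpos ht, sub_zero, norm_zero, mul_zero]
      positivity
    have hfy := (hfL y).Ioo_of_Ioi t
    have hfz := (hfL z).Ioo_of_Ioi t
    rw [hB₁.conv_sub ht hfy hfz]
    have hkt := ((memLp_ofReal_iff hp).1 (hu₁.Ioo_of_Ioi t)).2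
    have h1 : (∫ s in Ioo 0 t, ‖f y s - f z s‖ ^ p) ^ (1 / p) ≤
        L * (∫ s in Ioo 0 t, (dist y z * Real.exp (l * G s)) ^ p * ‖u₁ s‖ ^ p) ^ (1 / p) := by
      refine rpow_integral_le_const_mul hp hL.le (by fun_prop) (fun s => by positivity)
        (fun s => norm_nonneg _) hkt (fun s => norm_nonneg _) fun s _ => ?_
      refine (hlip _ _ _).trans ?_
      rw [← smul_sub, norm_smul, Real.norm_eq_abs, Real.abs_exp, ← dist_eq_norm]
      have := BoundedContinuousFunction.dist_coe_le_dist (f := y) (g := z) s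
      calc L * ‖u₁ s‖ * (Real.exp (l * G s) * dist (y s) (z s))
          ≤ L * ‖u₁ s‖ * (Real.exp (l * G s) * dist y z) := by gcongr
        _ = _ := by ring
    have h2 := rpow_integral_le_of_le_exp (k := fun s => ‖u₁ s‖ ^ p)
      (z := fun s => dist y z * Real.exp (l * G s)) (W := dist y z) hp ht hkt
      (fun s => by positivity) hl0 dist_nonneg (fun s _ => by positivity) (fun s _ => le_rfl)
    rw [hl, mul_growthRate_rpow (by positivity) hp, ← hl] at h2
    have h3 := hB₁.norm_conv_le hp hω hC₁.le ht (hfy.sub hfz)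
    calc Real.exp (-(l * G t)) * ‖E.conv B₁ (fun s => f y s - f z s) t‖
        ≤ Real.exp (-(l * G t)) *
          (C₁ * (L * (dist y z * Real.exp (l * G t) / (2 * (C₁ * L))))) := by
          gcongr
          refine h3.trans ?_
          gcongr
          exact h1.trans (mul_le_mul_of_nonneg_left h2 hL.le)
      _ = dist y z / 2 * (Real.exp (-(l * G t)) * Real.exp (l * G t)) := by field_simp
      _ = ((1 / 2 : ℝ≥0) : ℝ) * dist y z := by
          rw [← Real.exp_add, neg_add_cancel, Real.exp_zero]
          push_cast
          ring
  set y := hcontr.fixedPoint Φ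
  have hy : ∀ t, P y t = y t := fun t =>
    congrArg (fun g : ℝ →ᵇ X => g t) hcontr.fixedPoint_isFixedPt
  refine ⟨fun t => Real.exp (l * G t) • y t, by fun_prop, fun t ht => ?_⟩
  simp only
  rw [← hy t, hP]
  simp only
  rw [smul_smul, ← Real.exp_add, add_neg_cancel, Real.exp_zero, one_smul]
  simp only [S, max_eq_left ht, f]

lemma exists_solvesMildEquation [CompleteSpace X] [CompleteSpace Xm] {M : ℝ}
    (hM : 0 ≤ M) (hω : 0 ≤ ω) (hT : ∀ t : ℝ, 0 ≤ t → ‖T t‖ ≤ M * Real.exp (-ω * t))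
    (hp : 1 ≤ p) (hq : 1 ≤ q) (hC₁ : 0 < C₁) (hC₂ : 0 ≤ C₂)
    (hB₁ : IsWeightedAdmissible E ω p B₁ C₁)
    (hB₂ : IsWeightedAdmissible E ω q B₂ C₂) (hF : StandingAssumptions m F) (hm : 0 < m)
    (x₀ : X) (hu₁ : MemLp u₁ (ENNReal.ofReal p) (volume.restrict (Ioi 0)))
    (hu₂ : MemLp u₂ (ENNReal.ofReal q) (volume.restrict (Ioi 0))) :
    ∃ x, SolvesMildEquation E B₁ B₂ F x₀ u₁ u₂ x := by
  set R : ℝ := 2 * (M * ‖x₀‖ + C₂ * (∫ s in Ioi 0, ‖u₂ s‖ ^ q) ^ (1 / q)) *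
    Real.exp (growthRate (C₁ * m) p * ∫ s in Ioi 0, ‖u₁ s‖ ^ p) + 1 with hR
  have hR0 : 0 < R := by
    have : 0 ≤ ∫ s in Ioi 0, ‖u₂ s‖ ^ q := integral_nonneg fun s => by positivity
    positivity
  have hFR := hF.comp_radialRetraction hm.le hR0
  obtain ⟨L, hL, hlip⟩ := hF.exists_lipschitz_radialRetraction hR0
  have hT' : ∀ t : ℝ, 0 ≤ t → ‖T t‖ ≤ M := fun t ht => (hT t ht).trans
    (mul_le_of_le_one_right hM (Real.exp_le_one_iff.2 (by nlinarith [mul_nonneg hω ht])))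
  obtain ⟨x, hx⟩ := exists_solvesMildEquation_of_lipschitz hω hT' hp hq hC₁ hC₂ hB₁ hB₂ hFR hm.le
    hL hlip x₀ hu₁ hu₂
  have hxR : ∀ t, 0 ≤ t → ‖x t‖ ≤ R := fun t ht => by
    refine (hx.norm_le hM hω hT hp hq hC₁ hC₂ hB₁ hB₂ hFR hm hu₁ hu₂ ht).trans ?_
    have h0 : 0 ≤ ∫ s in Ioo 0 t, ‖u₂ s‖ ^ q := integral_nonneg fun s => by positivity
    have h1 : ∫ s in Ioo 0 t, ‖u₁ s‖ ^ p ≤ ∫ s in Ioi 0, ‖u₁ s‖ ^ p :=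
      setIntegral_mono_set ((memLp_ofReal_iff hp).1 hu₁).2 (ae_of_all _ fun s => by positivity)
        (show Ioo 0 t ⊆ Ioi 0 from Ioo_subset_Ioi_self).eventuallyLE
    have h2 : ∫ s in Ioo 0 t, ‖u₂ s‖ ^ q ≤ ∫ s in Ioi 0, ‖u₂ s‖ ^ q :=
      setIntegral_mono_set ((memLp_ofReal_iff hq).1 hu₂).2 (ae_of_all _ fun s => by positivity)
        (show Ioo 0 t ⊆ Ioi 0 from Ioo_subset_Ioi_self).eventuallyLE
    have h3 : M * Real.exp (-(ω * t / 2)) ≤ M :=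
      mul_le_of_le_one_right hM (Real.exp_le_one_iff.2 (by nlinarith [mul_nonneg hω ht]))
    have h4 : 0 < growthRate (C₁ * m) p := growthRate_pos (by positivity) hp
    rw [hR]
    refine le_trans ?_ (le_add_of_nonneg_right zero_le_one)
    gcongr
  refine ⟨x, hx.1, fun t ht => ?_⟩
  rw [hx.2 t ht, E.conv_congr (u := fun s => F (x s) (u₁ s))
    (v := fun s => F (radialRetraction R (x s)) (u₁ s))]
  intro s hs
  simp only [radialRetraction_of_norm_le hR0 (hxR s hs.1.le)]

end MildSolution

section ComparisonFunctions

lemma classKInfty_two_mul_add_sq {g : ℝ → ℝ} (hg : ClassKInfty g) :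
    ClassKInfty fun r => 2 * g r + 2 * g r ^ 2 := by
  obtain ⟨hc, hmono, h0, hpos, ht⟩ := hg
  refine ⟨by fun_prop, fun r hr s hs hrs => ?_, by simp [h0], fun s hs => ?_, ?_⟩
  · have := hmono hr hs hrs
    have := hpos r hr
    simp only
    gcongr
  · have := hpos s hs
    positivity
  · exact tendsto_atTop_mono (fun r => by nlinarith [sq_nonneg (g r)])
      (ht.const_mul_atTop (two_pos (α := ℝ)))

lemma classKInfty_const_mul_rpow {c q : ℝ} (hc : 0 < c) (hq : 0 < q) :
    ClassKInfty fun r => c * r ^ q := by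
  refine ⟨?_, fun r hr s _ hrs => ?_, by simp [Real.zero_rpow hq.ne'], fun s hs => ?_, ?_⟩
  · exact (continuous_const.mul (Real.continuous_rpow_const hq.le)).continuousOn
  · have := Real.rpow_lt_rpow hr hrs hq
    simp only
    gcongr
  · have : 0 ≤ s := hs
    positivity
  · exact (tendsto_rpow_atTop hq).const_mul_atTop hc

lemma classKInfty_exp_sub_one_sq {l : ℝ} (hl : 0 < l) :
    ClassKInfty fun r => (Real.exp (l * r) - 1) ^ 2 := by
  have hpos : ∀ r ∈ Ici (0 : ℝ), 0 ≤ Real.exp (l * r) - 1 := fun r hr =>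
    sub_nonneg.2 (Real.one_le_exp (mul_nonneg hl.le hr))
  refine ⟨by fun_prop, fun r hr s _ hrs => ?_, by simp, fun s _ => sq_nonneg _, ?_⟩
  · have := hpos r hr
    simp only
    gcongr
  · have h : Tendsto (fun r => Real.exp (l * r) - 1) atTop atTop :=
      tendsto_atTop_add_const_right _ _
        (Real.tendsto_exp_atTop.comp (tendsto_id.const_mul_atTop hl))
    exact (tendsto_pow_atTop two_ne_zero).comp h

lemma classKL_two_mul_add_sq {c w : ℝ} (hc : 0 < c) (hw : 0 < w) :
    ClassKL fun s t => 2 * (c * Real.exp (-(w * t)) * s) +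
      2 * (c * Real.exp (-(w * t)) * s) ^ 2 := by
  refine ⟨fun s t hs _ => by positivity, fun t _ => ⟨by fun_prop, fun r hr s _ hrs => ?_,
    by simp⟩, fun s hs => ⟨fun t _ t' _ htt' => ?_, ?_⟩⟩
  · have : 0 ≤ r := hr
    simp only
    gcongr
  · simp only
    gcongr
  · have h : Tendsto (fun t => c * Real.exp (-(w * t)) * s) atTop (𝓝 0) := by
      have := (Real.tendsto_exp_neg_atTop_nhds_zero.comp
        (tendsto_id.const_mul_atTop hw)).const_mul c |>.mul_const s
      simpa using this
    simpa using (h.const_mul 2).add ((h.pow 2).const_mul 2)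

end ComparisonFunctions

/-- Corollary (cor1): with an exponentially stable semigroup and uniformly bounded
admissibility constants for the rescaled semigroup, the bilinear system
`Σ(A,[B₁,B₂],F)` is integral input-to-state stable. -/
theorem bilinear_integral_ISS
    {X Xt U₁ U₂ Xm : Type*}
    [NormedAddCommGroup X] [NormedSpace ℝ X] [CompleteSpace X]
    [NormedAddCommGroup Xt] [NormedSpace ℝ Xt] [CompleteSpace Xt]
    [NormedAddCommGroup U₁] [NormedSpace ℝ U₁] [CompleteSpace U₁]
    [NormedAddCommGroup U₂] [NormedSpace ℝ U₂] [CompleteSpace U₂]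
    [NormedAddCommGroup Xm] [NormedSpace ℝ Xm] [CompleteSpace Xm]
    (T : C0Semigroup X) (M ω : ℝ) (hM : 1 ≤ M) (hω : 0 < ω)
    (hT : ∀ t : ℝ, 0 ≤ t → ‖T t‖ ≤ M * Real.exp (-ω * t))
    (E : Extrapolation Xm T)
    (p q : ℝ) (hp : 1 ≤ p) (hq : 1 ≤ q)
    (B₁ : Xt →L[ℝ] Xm) (B₂ : U₂ →L[ℝ] Xm)
    (CB₁ CB₂ : ℝ)
    (hB₁ : IsLpAdmissibleFor (fun t => Real.exp (ω * t / 2) • E.Tm t) E.ι p B₁ (fun _ => CB₁))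
    (hB₂ : IsLpAdmissibleFor (fun t => Real.exp (ω * t / 2) • E.Tm t) E.ι q B₂ (fun _ => CB₂))
    (m : ℝ) (hm : 0 < m) (F : X → U₁ → Xt) (hF : StandingAssumptions m F) :
    ∃ (β : ℝ → ℝ → ℝ) (θ₁ θ₂ : ℝ → ℝ),
      ClassKL β ∧ ClassKInfty θ₁ ∧ ClassKInfty θ₂ ∧
      ∀ (x₀ : X) (u₁ : ℝ → U₁) (u₂ : ℝ → U₂),
        AEStronglyMeasurable u₁ (volume.restrict (Set.Ioi 0)) →
        IntegrableOn (fun s => ‖u₁ s‖ ^ p) (Set.Ioi 0) →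
        AEStronglyMeasurable u₂ (volume.restrict (Set.Ioi 0)) →
        IntegrableOn (fun s => ‖u₂ s‖ ^ q) (Set.Ioi 0) →
        ∃ x : ℝ → X,
          IsGlobalMildSolution T E B₁ B₂ F x₀ u₁ u₂ x ∧
          (∀ y : ℝ → X, IsGlobalMildSolution T E B₁ B₂ F x₀ u₁ u₂ y →
            Set.EqOn y x (Set.Ici 0)) ∧
          ∀ t : ℝ, 0 ≤ t →
            ‖x t‖ ≤ β ‖x₀‖ t + θ₁ (∫ s in Set.Ioo 0 t, ‖u₁ s‖ ^ p)
              + θ₂ (∫ s in Set.Ioo 0 t, ‖u₂ s‖ ^ q) := by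
  have hB₁' := hB₁.isWeightedAdmissible hp
  have hB₂' := hB₂.isWeightedAdmissible hq
  set C₁ := max CB₁ 1
  set C₂ := max CB₂ 1
  have hC₁ : 0 < C₁ := lt_max_of_lt_right one_pos
  have hC₂ : 0 < C₂ := lt_max_of_lt_right one_pos
  have hM0 : 0 < M := one_pos.trans_le hM
  set l := growthRate (C₁ * m) p with hl
  have hl0 : 0 < l := growthRate_pos (by positivity) hp
  refine ⟨_, _, _, classKL_two_mul_add_sq hM0 (half_pos hω), classKInfty_exp_sub_one_sq hl0,
    classKInfty_two_mul_add_sq (classKInfty_const_mul_rpow hC₂ (q := 1 / q) (by positivity)),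
    fun x₀ u₁ u₂ hm₁ hi₁ hm₂ hi₂ => ?_⟩
  have hu₁ := (memLp_ofReal_iff hp).2 ⟨hm₁, hi₁⟩
  have hu₂ := (memLp_ofReal_iff hq).2 ⟨hm₂, hi₂⟩
  have hiff := fun x => isGlobalMildSolution_iff (x₀ := x₀) (x := x) hB₁' hB₂' hF hm.le hu₁ hu₂
  obtain ⟨x, hx⟩ := exists_solvesMildEquation hM0.le hω.le hT hp hq hC₁ hC₂.le hB₁' hB₂' hF hm x₀
    hu₁ hu₂
  refine ⟨x, (hiff x).2 hx, fun y hy => ((hiff y).1 hy).eqOn hω.le hp hC₁ hB₁' hF hm.le hu₁ hx,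
    fun t ht => ?_⟩
  have h := hx.norm_le hM0.le hω.le hT hp hq hC₁ hC₂.le hB₁' hB₂' hF hm hu₁ hu₂ ht
  rw [mul_div_right_comm ω t 2] at h
  set a := M * Real.exp (-(ω / 2 * t)) * ‖x₀‖
  set b := C₂ * (∫ s in Ioo 0 t, ‖u₂ s‖ ^ q) ^ (1 / q)
  set e := Real.exp (l * ∫ s in Ioo 0 t, ‖u₁ s‖ ^ p)
  change ‖x t‖ ≤ 2 * a + 2 * a ^ 2 + (e - 1) ^ 2 + (2 * b + 2 * b ^ 2)
  nlinarith [sq_nonneg (a - b), sq_nonneg (a + b - (e - 1))]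
end

section
/- Let X, X̃, U₁, U₂ be Banach spaces, let T be a C₀-semigroup on X with extrapolation setting (X₋₁, ι, T₋₁), and let p, q ∈ [1,∞). Suppose B₁ ∈ L(X̃, X₋₁) is L^p-admissible for T, B₂ ∈ L(U₂, X₋₁) is L^q-admissible for T, and F satisfies the standing assumptions. Then for every t₀ ≥ 0, x₀ ∈ X, u₁ ∈ L^p(0,∞;U₁) and u₂ ∈ L^q(0,∞;U₂) there exists t₁ > t₀ such that Σ(A,[B₁,B₂],F) possesses one and only one mild solution on [t₀,t₁] with initial value x₀ and inputs u₁, u₂. -/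
open MeasureTheory Set Filter

open scoped Topology ENNReal NNReal

/-- A map on a complete normed space which is bounded affinely with slope `1 / 2` and is a
contraction on the resulting invariant ball has exactly one fixed point in the whole space. -/
theorem exists_unique_fixedPoint_of_half_contracting {E : Type*} [NormedAddCommGroup E]
    [CompleteSpace E] (G : E → E) (H : ℝ) (hH : 0 ≤ H) (hG : ∀ f, ‖G f‖ ≤ H + ‖f‖ / 2)
    (hL : ∀ f g, ‖f‖ ≤ 2 * H → ‖g‖ ≤ 2 * H → ‖G f - G g‖ ≤ ‖f - g‖ / 2) :
    ∃ f, G f = f ∧ ∀ g, G g = g → g = f := by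
  have hmaps : MapsTo G (Metric.closedBall 0 (2 * H)) (Metric.closedBall 0 (2 * H)) := by
    intro f hf
    rw [mem_closedBall_zero_iff] at hf ⊢
    linarith [hG f]
  have hcontr : ContractingWith (1 / 2 : ℝ≥0) (hmaps.restrict G _ _) := by
    refine ⟨by rw [one_div]; exact two_inv_lt_one, LipschitzWith.of_dist_le_mul ?_⟩
    rintro ⟨f, hf⟩ ⟨g, hg⟩
    rw [mem_closedBall_zero_iff] at hf hg
    have := hL f g hf hg
    rw [Subtype.dist_eq, Subtype.dist_eq, dist_eq_norm, dist_eq_norm]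
    simp only [MapsTo.val_restrict_apply]
    push_cast
    linarith
  obtain ⟨f, hf, hfix, -⟩ := hcontr.exists_fixedPoint' (Metric.isClosed_closedBall.isComplete)
    hmaps (x := 0) (by simp [hH]) (edist_ne_top _ _)
  rw [mem_closedBall_zero_iff] at hf
  refine ⟨f, hfix, fun g hg => ?_⟩
  have hg' := hG g
  rw [hg] at hg'
  have hd := hL g f (by linarith) hf
  rw [hg, hfix.eq] at hd
  exact sub_eq_zero.1 (norm_le_zero_iff.1 (by linarith))

section Admissible

variable {X Xm U : Type*} [NormedAddCommGroup X] [NormedSpace ℝ X]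
  [NormedAddCommGroup Xm] [NormedSpace ℝ Xm] [NormedAddCommGroup U] [NormedSpace ℝ U]

/-- The input map at time `τ` of an admissible operator, as a bounded operator on `L^p(ℝ; U)`. -/
theorem IsLpAdmissibleFor.exists_inputMap {S : ℝ → Xm →L[ℝ] Xm} {ι : X →L[ℝ] Xm}
    (hι : Function.Injective ι) {p : ℝ} (hp : 1 ≤ p) {B : U →L[ℝ] Xm} {C : ℝ → ℝ}
    (hB : IsLpAdmissibleFor S ι p B C) [Fact (1 ≤ ENNReal.ofReal p)] {τ : ℝ} (hτ : 0 < τ) :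
    ∃ Ψ : Lp U (ENNReal.ofReal p) (volume : Measure ℝ) →L[ℝ] X, ∀ f,
      IntegrableOn (fun s => S (τ - s) (B (f s))) (Ioo 0 τ) ∧
      ι (Ψ f) = ∫ s in Ioo 0 τ, S (τ - s) (B (f s)) := by
  have hp0 : 0 < p := by linarith
  have hP0 : ENNReal.ofReal p ≠ 0 := by simpa using hp0
  have hPr : (ENNReal.ofReal p).toReal = p := ENNReal.toReal_ofReal hp0.le
  have key (f : Lp U (ENNReal.ofReal p) (volume : Measure ℝ)) :=
    hB τ hτ f (Lp.aestronglyMeasurable f).restrict (by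
      have := (integrable_norm_rpow_iff (Lp.aestronglyMeasurable f) hP0
        ENNReal.ofReal_ne_top).2 (Lp.memLp f)
      rw [hPr] at this
      exact this.integrableOn)
  choose hint Ψ hΨ hbound using key
  have hnorm (f : Lp U (ENNReal.ofReal p) (volume : Measure ℝ)) :
      (∫ s in Ioo 0 τ, ‖f s‖ ^ p) ^ (1 / p) ≤ ‖f‖ := by
    have hi := (integrable_norm_rpow_iff (Lp.aestronglyMeasurable f) hP0
      ENNReal.ofReal_ne_top).2 (Lp.memLp f)
    have hn : ∀ s, 0 ≤ ‖f s‖ ^ p := fun s => by positivity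
    rw [hPr] at hi
    rw [Lp.norm_def, (Lp.memLp f).eLpNorm_eq_integral_rpow_norm hP0 ENNReal.ofReal_ne_top, hPr,
      ENNReal.toReal_ofReal (Real.rpow_nonneg (integral_nonneg hn) _), one_div]
    exact Real.rpow_le_rpow (integral_nonneg hn)
      (setIntegral_le_integral hi (Eventually.of_forall hn)) (by positivity)
  refine ⟨LinearMap.mkContinuous
    { toFun := Ψ
      map_add' := fun f g => hι ?_
      map_smul' := fun c f => hι ?_ } |C τ| fun f => ?_, fun f => ⟨hint f, hΨ f⟩⟩
  · rw [map_add, hΨ, hΨ, hΨ, ← integral_add (hint f) (hint g)]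
    refine integral_congr_ae (ae_restrict_of_ae ?_)
    filter_upwards [Lp.coeFn_add f g] with s hs
    rw [hs, Pi.add_apply, map_add, map_add]
  · rw [RingHom.id_apply, map_smul, hΨ, hΨ, ← integral_smul]
    refine integral_congr_ae (ae_restrict_of_ae ?_)
    filter_upwards [Lp.coeFn_smul c f] with s hs
    simp [hs]
  · refine (hbound f).trans ?_
    have h0 : 0 ≤ (∫ s in Ioo 0 τ, ‖f s‖ ^ p) ^ (1 / p) :=
      Real.rpow_nonneg (integral_nonneg fun s => by positivity) _
    exact (mul_le_mul_of_nonneg_right (le_abs_self _) h0).trans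
      (mul_le_mul_of_nonneg_left (hnorm f) (abs_nonneg _))

/-- The input maps of an admissible operator on time intervals of length at most `τ`: they are
bounded uniformly in time and depend continuously on time. -/
theorem IsLpAdmissibleFor.exists_continuous_inputMap {S : ℝ → Xm →L[ℝ] Xm} {ι : X →L[ℝ] Xm}
    (hι : Function.Injective ι) {p : ℝ} (hp : 1 ≤ p) {B : U →L[ℝ] Xm} {C : ℝ → ℝ}
    (hB : IsLpAdmissibleFor S ι p B C) [Fact (1 ≤ ENNReal.ofReal p)] {τ : ℝ} (hτ : 0 < τ) :
    ∃ K : ℝ, 0 ≤ K ∧ ∃ Φ : ℝ → Lp U (ENNReal.ofReal p) (volume : Measure ℝ) → X,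
      (∀ w, Continuous fun t => Φ t w) ∧ (∀ t w, ‖Φ t w‖ ≤ K * ‖w‖) ∧
      (∀ t w w', ‖Φ t w - Φ t w'‖ ≤ K * ‖w - w'‖) ∧
      ∀ (w : Lp U (ENNReal.ofReal p) (volume : Measure ℝ)) (v : ℝ → U) (a b t : ℝ),
        w =ᵐ[volume] (Ioo a b).indicator v → t ≤ a + τ → t ≤ b →
        IntegrableOn (fun s => S (t - s) (B (v s))) (Ioo a t) ∧
        ι (Φ t w) = ∫ s in Ioo a t, S (t - s) (B (v s)) := by
  obtain ⟨Ψ, hΨ⟩ := hB.exists_inputMap hι hp hτ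
  have : Fact (ENNReal.ofReal p ≠ ∞) := ⟨ENNReal.ofReal_ne_top⟩
  have hnorm (t : ℝ) (w : Lp U (ENNReal.ofReal p) (volume : Measure ℝ)) :
      ‖Ψ (DomAddAct.mk (t - τ) +ᵥ w)‖ ≤ ‖Ψ‖ * ‖w‖ := by
    simpa using Ψ.le_opNorm (DomAddAct.mk (t - τ) +ᵥ w)
  refine ⟨‖Ψ‖, norm_nonneg _, fun t w => Ψ (DomAddAct.mk (t - τ) +ᵥ w), fun w => ?_, hnorm,
    fun t w w' => ?_, ?_⟩
  · have h : Continuous fun t : ℝ => DomAddAct.mk (t - τ) :=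
      DomAddAct.continuous_mk.comp (by fun_prop)
    exact Ψ.continuous.comp (h.vadd continuous_const)
  · rw [← map_sub, ← DomAddAct.vadd_Lp_sub]
    exact hnorm t _
  · intro w v a b t hw hta htb
    set c := t - τ with hc
    obtain ⟨hint, heq⟩ := hΨ (DomAddAct.mk c +ᵥ w)
    set g : ℝ → Xm := (Ioo a b).indicator fun s => S (t - s) (B (v s)) with hg
    have hae : (fun s => S (τ - s) (B ((DomAddAct.mk c +ᵥ w :
        Lp U (ENNReal.ofReal p) (volume : Measure ℝ)) s))) =ᵐ[volume] fun s => g (c + s) := by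
      have h2 :=
        (measurePreserving_add_left (volume : Measure ℝ) c).quasiMeasurePreserving.ae_eq_comp hw
      filter_upwards [DomAddAct.vadd_Lp_ae_eq (DomAddAct.mk c) w, h2] with s hs hs2
      have h3 : w (c + s) = (Ioo a b).indicator v (c + s) := hs2
      rw [hs]
      simp only [Equiv.symm_apply_apply, vadd_eq_add]
      rw [h3, hg]
      by_cases hm : c + s ∈ Ioo a b
      · rw [indicator_of_mem hm, indicator_of_mem hm, show t - (c + s) = τ - s by rw [hc]; ring]
      · rw [indicator_of_notMem hm, indicator_of_notMem hm]; simp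
    have hpre : (fun s => c + s) ⁻¹' (Ioo c t) = Ioo 0 τ := by
      rw [preimage_const_add_Ioo]; simp [hc]
    have hemb := measurableEmbedding_addLeft c
    have hmp := measurePreserving_add_left (volume : Measure ℝ) c
    have hinter : Ioo c t ∩ Ioo a b = Ioo a t := by
      rw [Ioo_inter_Ioo, sup_eq_right.2 (by linarith), inf_eq_left.2 htb]
    have hint2 : IntegrableOn g (Ioo c t) := by
      rw [← hmp.integrableOn_comp_preimage hemb, hpre]
      exact hint.congr_fun_ae (ae_restrict_of_ae hae)
    constructor
    · rwa [hg, IntegrableOn, integrable_indicator_iff measurableSet_Ioo, IntegrableOn,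
        Measure.restrict_restrict measurableSet_Ioo, inter_comm, hinter] at hint2
    · rw [heq, integral_congr_ae (ae_restrict_of_ae hae), ← hpre,
        hmp.setIntegral_preimage_emb hemb, hg, setIntegral_indicator measurableSet_Ioo, hinter]

end Admissible

/-- The nonlinearity maps a bounded continuous state and an `L^p` input to an `L^p` function. -/
theorem StandingAssumptions.memLp_indicator {X U₁ Xt : Type*}
    [NormedAddCommGroup X] [NormedSpace ℝ X] [NormedAddCommGroup U₁] [NormedSpace ℝ U₁]
    [NormedAddCommGroup Xt] [NormedSpace ℝ Xt] {m : ℝ} (hm : 0 ≤ m) {F : X → U₁ → Xt}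
    (hF : StandingAssumptions m F) {P : ℝ≥0∞} {s : Set ℝ} (hs : MeasurableSet s) {u : ℝ → U₁}
    (hu : MemLp (s.indicator u) P) {x : ℝ → X} (hx : Continuous x) {M : ℝ}
    (hM : ∀ r, ‖x r‖ ≤ M) :
    MemLp (s.indicator fun r => F (x r) (u r)) P := by
  refine hu.of_le_mul (c := m * M) ?_ (Eventually.of_forall fun r => ?_)
  · have h := (aestronglyMeasurable_indicator_iff hs).1 hu.1
    refine (aestronglyMeasurable_indicator_iff hs).2
      ⟨_, hF.stronglyMeasurable_comp x _ hx.stronglyMeasurable h.stronglyMeasurable_mk, ?_⟩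
    filter_upwards [h.ae_eq_mk] with r hr
    rw [← hr]
  · by_cases hr : r ∈ s
    · rw [indicator_of_mem hr, indicator_of_mem hr]
      exact (hF.norm_bound _ _).trans
        (mul_le_mul_of_nonneg_right (mul_le_mul_of_nonneg_left (hM r) hm) (norm_nonneg _))
    · rw [indicator_of_notMem hr, indicator_of_notMem hr]
      simp

/-- A measurable function whose `p`-th power is integrable on `s` lies in `L^p` once it is
truncated to a measurable subset of `s`. -/
theorem memLp_indicator_of_integrableOn_rpow {U : Type*} [NormedAddCommGroup U] {p : ℝ}
    (hp : 0 < p) {s t : Set ℝ} (ht : MeasurableSet t) (hts : t ⊆ s) {u : ℝ → U}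
    (hm : AEStronglyMeasurable u (volume.restrict s))
    (hi : IntegrableOn (fun r => ‖u r‖ ^ p) s) :
    MemLp (t.indicator u) (ENNReal.ofReal p) volume := by
  rw [memLp_indicator_iff_restrict ht]
  have hm' := hm.mono_set hts
  rw [← integrable_norm_rpow_iff hm' (by simpa using hp) ENNReal.ofReal_ne_top,
    ENNReal.toReal_ofReal hp.le]
  exact hi.mono_set hts

/-- Proposition (thm1), local existence and uniqueness of mild solutions for the
bilinear system `Σ(A,[B₁,B₂],F)` with `L^p`-admissible `B₁` and `L^q`-admissible `B₂`. -/
theorem bilinear_local_existence_uniqueness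
    {X Xt U₁ U₂ Xm : Type*}
    [NormedAddCommGroup X] [NormedSpace ℝ X] [CompleteSpace X]
    [NormedAddCommGroup Xt] [NormedSpace ℝ Xt] [CompleteSpace Xt]
    [NormedAddCommGroup U₁] [NormedSpace ℝ U₁] [CompleteSpace U₁]
    [NormedAddCommGroup U₂] [NormedSpace ℝ U₂] [CompleteSpace U₂]
    [NormedAddCommGroup Xm] [NormedSpace ℝ Xm] [CompleteSpace Xm]
    (T : C0Semigroup X) (E : Extrapolation Xm T)
    (p q : ℝ) (hp : 1 ≤ p) (hq : 1 ≤ q)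
    (B₁ : Xt →L[ℝ] Xm) (B₂ : U₂ →L[ℝ] Xm) (C₁ C₂ : ℝ → ℝ)
    (hB₁ : IsLpAdmissibleFor (fun t => E.Tm t) E.ι p B₁ C₁)
    (hB₂ : IsLpAdmissibleFor (fun t => E.Tm t) E.ι q B₂ C₂)
    (m : ℝ) (hm : 0 < m) (F : X → U₁ → Xt) (hF : StandingAssumptions m F)
    (t₀ : ℝ) (ht₀ : 0 ≤ t₀) (x₀ : X) (u₁ : ℝ → U₁) (u₂ : ℝ → U₂)
    (hu₁m : AEStronglyMeasurable u₁ (volume.restrict (Set.Ioi 0)))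
    (hu₁p : IntegrableOn (fun s => ‖u₁ s‖ ^ p) (Set.Ioi 0))
    (hu₂m : AEStronglyMeasurable u₂ (volume.restrict (Set.Ioi 0)))
    (hu₂q : IntegrableOn (fun s => ‖u₂ s‖ ^ q) (Set.Ioi 0)) :
    ∃ t₁ : ℝ, t₀ < t₁ ∧
      ∃ x : ℝ → X, IsMildSolutionOn T E B₁ B₂ F x₀ u₁ u₂ t₀ t₁ x ∧
        ∀ y : ℝ → X, IsMildSolutionOn T E B₁ B₂ F x₀ u₁ u₂ t₀ t₁ y →
          Set.EqOn y x (Set.Icc t₀ t₁) := by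
  have : Fact (1 ≤ ENNReal.ofReal p) := ⟨by simpa using hp⟩
  have : Fact (1 ≤ ENNReal.ofReal q) := ⟨by simpa using hq⟩
  obtain ⟨K₁, hK₁, Φ₁, hc₁, hb₁, hl₁, hr₁⟩ :=
    IsLpAdmissibleFor.exists_continuous_inputMap (S := E.Tm.toFun) E.ι_injective hp hB₁ one_pos
  obtain ⟨-, -, Φ₂, hc₂, -, -, hr₂⟩ :=
    IsLpAdmissibleFor.exists_continuous_inputMap (S := E.Tm.toFun) E.ι_injective hq hB₂ one_pos
  have hv₂ : MemLp ((Ioo t₀ (t₀ + 1)).indicator u₂) (ENNReal.ofReal q) volume :=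
    memLp_indicator_of_integrableOn_rpow (by linarith) measurableSet_Ioo
      (fun r hr => ht₀.trans_lt hr.1) hu₂m hu₂q
  set w₂ := hv₂.toLp
  set h : ℝ → X := fun t => T (t - t₀) x₀ + Φ₂ t w₂ with hh
  have hcont : ContinuousOn h (Icc t₀ (t₀ + 1)) := by
    refine ContinuousOn.add ?_ (hc₂ w₂).continuousOn
    exact (T.continuousOn_apply' x₀).comp (by fun_prop) fun t ht => sub_nonneg.2 ht.1
  obtain ⟨H₀, hH₀⟩ := isCompact_Icc.exists_bound_of_continuousOn hcont
  set H := max H₀ 0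
  have hH : 0 ≤ H := le_max_right _ _
  obtain ⟨L, hL, hLip⟩ := hF.lipschitz _ (Metric.isBounded_closedBall (x := (0 : X)) (r := 2 * H))
  have hden : 0 < K₁ * (m + L) + 1 := by positivity
  set ε := 1 / (2 * (K₁ * (m + L) + 1)) with hε
  have hεpos : 0 < ε := by positivity
  have hεle : K₁ * (m + L) * ε ≤ 1 / 2 := by
    rw [hε, mul_one_div, div_le_div_iff₀ (by positivity) (by positivity)]
    linarith
  have hKm : K₁ * m * ε ≤ 1 / 2 := by nlinarith [mul_nonneg (mul_nonneg hK₁ hL.le) hεpos.le]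
  have hKL : K₁ * L * ε ≤ 1 / 2 := by nlinarith [mul_nonneg (mul_nonneg hK₁ hm.le) hεpos.le]
  obtain ⟨δ, hδ, hδε⟩ := (memLp_indicator_of_integrableOn_rpow (by linarith) measurableSet_Ioi
    subset_rfl hu₁m hu₁p).eLpNorm_indicator_le Fact.out ENNReal.ofReal_ne_top hεpos
  set t₁ := t₀ + min δ 1
  have hmin : 0 < min δ 1 := lt_min hδ one_pos
  have h01 : t₀ ≤ t₁ := by linarith
  have h11 : t₁ ≤ t₀ + 1 := by linarith [min_le_right δ 1]
  have hsub : Ioo t₀ t₁ ⊆ Ioi 0 := fun r hr => ht₀.trans_lt hr.1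
  have hv₁ : MemLp ((Ioo t₀ t₁).indicator u₁) (ENNReal.ofReal p) volume :=
    memLp_indicator_of_integrableOn_rpow (by linarith) measurableSet_Ioo hsub hu₁m hu₁p
  have hnorm : ‖hv₁.toLp‖ ≤ ε := by
    have h1 := hδε (Ioo t₀ t₁) measurableSet_Ioo (by
      rw [Real.volume_Ioo]
      exact ENNReal.ofReal_le_ofReal (by linarith [min_le_left δ 1]))
    rw [indicator_indicator, inter_eq_left.2 hsub] at h1
    rw [Lp.norm_toLp]
    exact ENNReal.toReal_le_of_le_ofReal hεpos.le h1
  have hN (f : C(Icc t₀ t₁, X)) :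
      MemLp ((Ioo t₀ t₁).indicator fun s => F (IccExtend h01 f s) (u₁ s))
        (ENNReal.ofReal p) volume :=
    hF.memLp_indicator hm.le measurableSet_Ioo hv₁ f.continuous.Icc_extend'
      fun r => f.norm_coe_le_norm _
  have hNb (f : C(Icc t₀ t₁, X)) : ‖(hN f).toLp‖ ≤ m * ‖f‖ * ‖hv₁.toLp‖ := by
    refine Lp.norm_le_mul_norm_of_ae_le_mul ?_
    filter_upwards [(hN f).coeFn_toLp, hv₁.coeFn_toLp] with s hs hs'
    rw [hs, hs']
    by_cases hsI : s ∈ Ioo t₀ t₁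
    · rw [indicator_of_mem hsI, indicator_of_mem hsI]
      refine (hF.norm_bound _ _).trans ?_
      gcongr
      exact f.norm_coe_le_norm _
    · simp [indicator_of_notMem hsI]
  have hNl (f g : C(Icc t₀ t₁, X)) (hf : ‖f‖ ≤ 2 * H) (hg : ‖g‖ ≤ 2 * H) :
      ‖(hN f).toLp - (hN g).toLp‖ ≤ L * ‖f - g‖ * ‖hv₁.toLp‖ := by
    refine Lp.norm_le_mul_norm_of_ae_le_mul ?_
    filter_upwards [(hN f).coeFn_toLp, (hN g).coeFn_toLp, hv₁.coeFn_toLp,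
      Lp.coeFn_sub (hN f).toLp (hN g).toLp] with s hs hs' hs'' hsub
    rw [hsub, Pi.sub_apply, hs, hs', hs'']
    by_cases hsI : s ∈ Ioo t₀ t₁
    · rw [indicator_of_mem hsI, indicator_of_mem hsI, indicator_of_mem hsI]
      refine (hLip _ ?_ _ ?_ _).trans ?_
      · exact mem_closedBall_zero_iff.2 ((f.norm_coe_le_norm _).trans hf)
      · exact mem_closedBall_zero_iff.2 ((g.norm_coe_le_norm _).trans hg)
      · rw [mul_right_comm]
        gcongr
        exact (f - g).norm_coe_le_norm _
    · simp [indicator_of_notMem hsI]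
  set G : C(Icc t₀ t₁, X) → C(Icc t₀ t₁, X) := fun f =>
    ⟨fun t => h t + Φ₁ t (hN f).toLp,
      (continuousOn_iff_continuous_domRestrict.1 (hcont.mono (Icc_subset_Icc_right h11))).add
        ((hc₁ _).comp continuous_subtype_val)⟩
  have hG (f : C(Icc t₀ t₁, X)) (t : Icc t₀ t₁) : G f t = h t + Φ₁ t (hN f).toLp := rfl
  have hGb (f : C(Icc t₀ t₁, X)) : ‖G f‖ ≤ H + ‖f‖ / 2 := by
    refine (ContinuousMap.norm_le _ (by positivity)).2 fun t => (norm_add_le _ _).trans ?_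
    refine add_le_add ((hH₀ t ⟨t.2.1, t.2.2.trans h11⟩).trans (le_max_left _ _)) ?_
    calc ‖Φ₁ t (hN f).toLp‖ ≤ K₁ * (m * ‖f‖ * ε) :=
          (hb₁ _ _).trans (by gcongr; exact (hNb f).trans (by gcongr))
      _ = K₁ * m * ε * ‖f‖ := by ring
      _ ≤ 1 / 2 * ‖f‖ := by gcongr
      _ = ‖f‖ / 2 := by ring
  have hGl (f g : C(Icc t₀ t₁, X)) (hf : ‖f‖ ≤ 2 * H) (hg : ‖g‖ ≤ 2 * H) :
      ‖G f - G g‖ ≤ ‖f - g‖ / 2 := by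
    refine (ContinuousMap.norm_le _ (by positivity)).2 fun t => ?_
    calc ‖(G f - G g) t‖ = ‖Φ₁ t (hN f).toLp - Φ₁ t (hN g).toLp‖ := by
          rw [ContinuousMap.sub_apply, hG, hG, add_sub_add_left_eq_sub]
      _ ≤ K₁ * (L * ‖f - g‖ * ε) :=
          (hl₁ _ _ _).trans (by gcongr; exact (hNl f g hf hg).trans (by gcongr))
      _ = K₁ * L * ε * ‖f - g‖ := by ring
      _ ≤ 1 / 2 * ‖f - g‖ := by gcongr
      _ = ‖f - g‖ / 2 := by ring
  have hGι (f : C(Icc t₀ t₁, X)) (t : Icc t₀ t₁) :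
      IntegrableOn (fun s => E.Tm (t - s) (B₁ (F (IccExtend h01 f s) (u₁ s)) + B₂ (u₂ s)))
        (Ioo t₀ t) ∧
      E.ι (G f t) = E.ι (T (t - t₀) x₀) +
        ∫ s in Ioo t₀ t, E.Tm (t - s) (B₁ (F (IccExtend h01 f s) (u₁ s)) + B₂ (u₂ s)) := by
    obtain ⟨i₁, e₁⟩ := hr₁ _ _ t₀ t₁ t (hN f).coeFn_toLp (t.2.2.trans h11) t.2.2
    obtain ⟨i₂, e₂⟩ := hr₂ w₂ u₂ t₀ (t₀ + 1) t hv₂.coeFn_toLp (t.2.2.trans h11)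
      (t.2.2.trans h11)
    simp only [map_add]
    refine ⟨i₁.add i₂, ?_⟩
    rw [integral_add i₁ i₂, ← e₁, ← e₂, hG]
    simp only [hh, map_add]
    abel
  obtain ⟨f, hf, huniq⟩ := exists_unique_fixedPoint_of_half_contracting G H hH hGb hGl
  refine ⟨t₁, by linarith, IccExtend h01 f, ⟨f.continuous.Icc_extend'.continuousOn,
    fun t ht => ?_⟩, fun y hy t ht => ?_⟩
  · have h1 := hGι f ⟨t, ht⟩
    rw [hf] at h1
    rwa [IccExtend_of_mem h01 f ht]
  · set g : C(Icc t₀ t₁, X) := ⟨(Icc t₀ t₁).domRestrict y,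
      continuousOn_iff_continuous_domRestrict.1 hy.1⟩
    have hgy : ∀ s ∈ Icc t₀ t₁, IccExtend h01 g s = y s := fun s hs => by
      rw [IccExtend_of_mem h01 g hs]; rfl
    have hfix : G g = g := by
      ext r
      apply E.ι_injective
      rw [(hGι g r).2, show g r = y r from rfl, (hy.2 r r.2).2]
      congr 1
      refine setIntegral_congr_fun measurableSet_Ioo fun s hs => ?_
      simp only [hgy s ⟨hs.1.le, hs.2.le.trans r.2.2⟩]
    rw [← hgy t ht, huniq g hfix]
end

section
/- Let X be a Banach space, let T be a C₀-semigroup of type (M,ω) on X (M ≥ 1, ω ∈ ℝ), let x₀ ∈ X and let u ∈ L¹_loc(0,∞;ℝ). Then there exists a unique continuous function x : [0,∞) → X satisfying x(t) = T(t)x₀ + ∫₀ᵗ u(s) T(t−s)x(s) ds for all t ≥ 0, and this function satisfies ‖x(t)‖ ≤ M e^{−ωt} e^{M ∫₀ᵗ |u(s)| ds} ‖x₀‖ for all t ≥ 0. In particular, if ω > 0 the bilinear system ẋ = Ax + u(t)x is integral input-to-state stable. -/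
open MeasureTheory Set Filter

/-- The composition of a `C¹` function with an absolutely continuous function is absolutely
continuous. -/
theorem ContDiff.comp_absolutelyContinuousOnInterval {φ f : ℝ → ℝ} {a b : ℝ}
    (hφ : ContDiff ℝ 1 φ) (hf : AbsolutelyContinuousOnInterval f a b) :
    AbsolutelyContinuousOnInterval (fun t => φ (f t)) a b := by
  obtain ⟨R, hR⟩ := hf.exists_bound
  obtain ⟨K, hK⟩ := hφ.contDiffOn.exists_lipschitzOnWith (s := Set.Icc (-R) R) (by decide)
    (convex_Icc _ _) isCompact_Icc
  have hmem : ∀ s ∈ Set.uIcc a b, f s ∈ Set.Icc (-R) R := fun s hs => abs_le.1 (hR s hs)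
  have hlim := (show Tendsto _ _ _ from hf).const_mul (K : ℝ)
  rw [mul_zero] at hlim
  refine squeeze_zero' (Eventually.of_forall fun E => Finset.sum_nonneg fun i _ => dist_nonneg)
    ?_ hlim
  filter_upwards [mem_inf_of_right (mem_principal_self _)] with E hE
  rw [Finset.mul_sum]
  exact Finset.sum_le_sum fun i hi =>
    hK.dist_le_mul _ (hmem _ (hE.1 i hi).1) _ (hmem _ (hE.1 i hi).2)

/-- If `G` is the primitive of an integrable function `g`, then `exp G` is a primitive of `g exp G`. -/
theorem integral_mul_exp_integral {g : ℝ → ℝ} {a b : ℝ} (hg : IntervalIntegrable g volume a b) :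
    ∫ s in a..b, g s * Real.exp (∫ r in a..s, g r) = Real.exp (∫ r in a..b, g r) - 1 := by
  have hac := Real.contDiff_exp.comp_absolutelyContinuousOnInterval
    (hg.absolutelyContinuousOnInterval_intervalIntegral (c := a) Set.left_mem_uIcc)
  have hftc := hac.integral_deriv_eq_sub
  rw [intervalIntegral.integral_same, Real.exp_zero] at hftc
  rw [← hftc]
  refine intervalIntegral.integral_congr_ae ?_
  filter_upwards [hg.ae_hasDerivAt_integral] with s hs hmem
  rw [(hs (Set.uIoc_subset_uIcc hmem) a Set.left_mem_uIcc).exp.deriv, mul_comm]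

theorem IntervalIntegrable.mul_exp_integral {g : ℝ → ℝ} {a b : ℝ}
    (hg : IntervalIntegrable g volume a b) :
    IntervalIntegrable (fun s => g s * Real.exp (∫ r in a..s, g r)) volume a b :=
  hg.mul_continuousOn
    (Real.continuous_exp.comp_continuousOn
      (intervalIntegral.continuousOn_primitive_interval' hg Set.left_mem_uIcc))

/-- A continuous function whose norm is bounded by the integral of `g ‖d‖`, with `g ≥ 0`
integrable, vanishes. -/
theorem eqOn_zero_of_norm_le_integral_mul_norm {X : Type*} [NormedAddCommGroup X]
    {d : ℝ → X} {g : ℝ → ℝ} {a b : ℝ} (hab : a ≤ b)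
    (hd : ContinuousOn d (Set.Icc a b)) (hg : IntervalIntegrable g volume a b) (hg0 : ∀ s, 0 ≤ g s)
    (hle : ∀ t ∈ Set.Icc a b, ‖d t‖ ≤ ∫ s in a..t, g s * ‖d s‖) :
    ∀ t ∈ Set.Icc a b, d t = 0 := by
  set V : ℝ → ℝ := fun t => ∫ s in a..t, 2 * g s with hV
  have hg2 : IntervalIntegrable (fun s => 2 * g s) volume a b := hg.const_mul 2
  have hVc : ContinuousOn V (Set.Icc a b) := by
    have := intervalIntegral.continuousOn_primitive_interval' hg2 Set.left_mem_uIcc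
    rwa [Set.uIcc_of_le hab] at this
  obtain ⟨τ, hτ, hmax⟩ := isCompact_Icc.exists_isMaxOn (Set.nonempty_Icc.2 hab)
    (f := fun t => Real.exp (-V t) * ‖d t‖)
    ((Real.continuous_exp.comp_continuousOn hVc.neg).mul hd.norm)
  set K := Real.exp (-V τ) * ‖d τ‖ with hK
  have hdK : ∀ t ∈ Set.Icc a b, ‖d t‖ ≤ K * Real.exp (V t) := fun t ht => by
    have h : Real.exp (-V t) * ‖d t‖ ≤ K := hmax ht
    rwa [Real.exp_neg, inv_mul_le_iff₀ (Real.exp_pos _), mul_comm] at h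
  have hsub : Set.uIcc a τ ⊆ Set.uIcc a b := by
    rw [Set.uIcc_of_le hτ.1, Set.uIcc_of_le hab]; exact Set.Icc_subset_Icc_right hτ.2
  have hgτ := hg.mono_set hsub
  have hg2τ := hg2.mono_set hsub
  have hdτ : ContinuousOn (fun s => ‖d s‖) (Set.uIcc a τ) :=
    hd.norm.mono (by rwa [Set.uIcc_of_le hab] at hsub)
  have hbound : ‖d τ‖ ≤ K / 2 * (Real.exp (V τ) - 1) := by
    rw [hV, ← integral_mul_exp_integral hg2τ, ← intervalIntegral.integral_const_mul]
    refine (hle τ hτ).trans (intervalIntegral.integral_mono_on hτ.1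
      (hgτ.mul_continuousOn hdτ) (hg2τ.mul_exp_integral.const_mul _) fun s hs => ?_)
    have := mul_le_mul_of_nonneg_left (hdK s ⟨hs.1, hs.2.trans hτ.2⟩) (hg0 s)
    linarith
  have hK0 : 0 ≤ K := by positivity
  have hKle : K ≤ 0 := by
    have h := mul_le_mul_of_nonneg_left hbound (Real.exp_pos (-V τ)).le
    have he : Real.exp (-V τ) * Real.exp (V τ) = 1 := by rw [← Real.exp_add]; simp
    have : Real.exp (-V τ) * (K / 2 * (Real.exp (V τ) - 1)) =
        K / 2 - K / 2 * Real.exp (-V τ) := by linear_combination K / 2 * he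
    nlinarith [mul_nonneg hK0 (Real.exp_pos (-V τ)).le]
  intro t ht
  have := hdK t ht
  rw [le_antisymm hKle hK0, zero_mul] at this
  exact norm_le_zero_iff.1 this

/-- The operator norms of an exponentially bounded semigroup are uniformly bounded on bounded
time intervals. -/
theorem C0Semigroup.norm_le_of_mem_Icc {X : Type*} [NormedAddCommGroup X] [NormedSpace ℝ X]
    {T : C0Semigroup X} {M ω : ℝ} (hM : 0 ≤ M)
    (hT : ∀ t : ℝ, 0 ≤ t → ‖T t‖ ≤ M * Real.exp (-ω * t)) {t τ : ℝ} (ht : t ∈ Set.Icc 0 τ) :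
    ‖T t‖ ≤ M * Real.exp (|ω| * τ) := by
  refine (hT t ht.1).trans ?_
  gcongr
  · exact ht.1
  · exact neg_le_abs ω
  · exact ht.2

/-- The scalar bilinear system `ẋ = Ax + u(t)x`: for every `x₀ ∈ X` and every
`u ∈ L¹_loc(0,∞;ℝ)` there is a unique continuous mild solution, and it satisfies the
integral-ISS type bound `‖x(t)‖ ≤ M e^{−ωt} e^{M∫₀ᵗ|u|} ‖x₀‖`. -/
theorem scalar_bilinear_system_iISS
    {X : Type*} [NormedAddCommGroup X] [NormedSpace ℝ X] [CompleteSpace X]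
    (T : C0Semigroup X) (M ω : ℝ) (hM : 1 ≤ M)
    (hT : ∀ t : ℝ, 0 ≤ t → ‖T t‖ ≤ M * Real.exp (-ω * t))
    (x₀ : X) (u : ℝ → ℝ)
    (hu : ∀ t : ℝ, 0 < t → IntegrableOn u (Set.Ioo 0 t)) :
    ∃ x : ℝ → X,
      (ContinuousOn x (Set.Ici 0) ∧
        ∀ t : ℝ, 0 ≤ t →
          IntegrableOn (fun s => u s • T (t - s) (x s)) (Set.Ioo 0 t) ∧
          x t = T t x₀ + ∫ s in Set.Ioo 0 t, u s • T (t - s) (x s)) ∧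
      (∀ y : ℝ → X,
        (ContinuousOn y (Set.Ici 0) ∧
          ∀ t : ℝ, 0 ≤ t →
            IntegrableOn (fun s => u s • T (t - s) (y s)) (Set.Ioo 0 t) ∧
            y t = T t x₀ + ∫ s in Set.Ioo 0 t, u s • T (t - s) (y s)) →
        Set.EqOn y x (Set.Ici 0)) ∧
      ∀ t : ℝ, 0 ≤ t →
        ‖x t‖ ≤ M * Real.exp (-ω * t) *
          Real.exp (M * ∫ s in Set.Ioo 0 t, |u s|) * ‖x₀‖ := by
  have hui : ∀ t : ℝ, 0 ≤ t → IntervalIntegrable u volume 0 t := fun t ht => by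
    rcases ht.eq_or_lt with rfl | h
    · exact IntervalIntegrable.refl
    · exact (intervalIntegrable_iff_integrableOn_Ioo_of_le ht).2 (hu t h)
  have hIoo : ∀ (f : ℝ → ℝ) (t : ℝ), 0 ≤ t →
      ∫ s in Set.Ioo 0 t, f s = ∫ s in (0 : ℝ)..t, f s := fun f t ht => by
    rw [intervalIntegral.integral_of_le ht, integral_Ioc_eq_integral_Ioo]
  have hM0 : 0 ≤ M := zero_le_one.trans hM
  set U : ℝ → ℝ := fun t => ∫ s in (0 : ℝ)..t, u s with hU
  set x : ℝ → X := fun t => Real.exp (U t) • T t x₀ with hx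
  have hUc : ContinuousOn U (Set.Ici 0) := fun t ht => by
    have ht0 : (0 : ℝ) ≤ t := ht
    have h := intervalIntegral.continuousOn_primitive_interval' (hui (t + 1) (by linarith))
      Set.left_mem_uIcc
    rw [Set.uIcc_of_le (by linarith)] at h
    refine (h t ⟨ht0, by linarith⟩).mono_of_mem_nhdsWithin ?_
    filter_upwards [self_mem_nhdsWithin, mem_nhdsWithin_of_mem_nhds (Iic_mem_nhds (lt_add_one t))]
      with s hs hs' using ⟨hs, hs'⟩
  have hxc : ContinuousOn x (Set.Ici 0) :=
    (Real.continuous_exp.comp_continuousOn hUc).smul (T.continuousOn_apply' x₀)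
  have hker : ∀ t : ℝ, Set.EqOn (fun s => u s • T (t - s) (x s))
      (fun s => (u s * Real.exp (U s)) • T t x₀) (Set.Ioo 0 t) := fun t s hs => by
    have h : T t = (T (t - s)).comp (T s) := by
      rw [← T.map_add' _ _ (sub_nonneg.2 hs.2.le) hs.1.le, sub_add_cancel]
    simp only [hx, h, map_smul, smul_smul, ContinuousLinearMap.comp_apply]
  have hxsol : ∀ t : ℝ, 0 ≤ t → IntegrableOn (fun s => u s • T (t - s) (x s)) (Set.Ioo 0 t) ∧
      x t = T t x₀ + ∫ s in Set.Ioo 0 t, u s • T (t - s) (x s) := fun t ht => by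
    constructor
    · refine IntegrableOn.congr_fun ?_ (hker t).symm measurableSet_Ioo
      exact Integrable.smul_const
        ((intervalIntegrable_iff_integrableOn_Ioo_of_le ht).1 (hui t ht).mul_exp_integral) _
    · rw [setIntegral_congr_fun measurableSet_Ioo (hker t), integral_smul_const, hIoo _ t ht,
        integral_mul_exp_integral (hui t ht), sub_smul, one_smul, add_sub_cancel]
  refine ⟨x, ⟨hxc, hxsol⟩, ?_, ?_⟩
  · rintro y ⟨hyc, hysol⟩ τ hτ
    set C := M * Real.exp (|ω| * τ) with hC
    have hC0 : 0 ≤ C := by positivity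
    have hτ0 : (0 : ℝ) ≤ τ := hτ
    have hdc : ContinuousOn (fun t => y t - x t) (Set.Ici 0) := hyc.sub hxc
    refine sub_eq_zero.1 (eqOn_zero_of_norm_le_integral_mul_norm (d := fun t => y t - x t)
      (g := fun s => C * |u s|) hτ0 (hdc.mono Set.Icc_subset_Ici_self)
      ((hui τ hτ0).abs.const_mul C) (fun s => by positivity) (fun t ht => ?_) τ ⟨hτ0, le_rfl⟩)
    obtain ⟨hyi, hye⟩ := hysol t ht.1
    obtain ⟨hxi, hxe⟩ := hxsol t ht.1
    have hgi : IntervalIntegrable (fun s => C * |u s| * ‖y s - x s‖) volume 0 t :=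
      ((hui t ht.1).abs.const_mul C).mul_continuousOn
        (hdc.norm.mono (by rw [Set.uIcc_of_le ht.1]; exact Set.Icc_subset_Ici_self))
    have hdiff : y t - x t =
        ∫ s in Set.Ioo 0 t, (u s • T (t - s) (y s) - u s • T (t - s) (x s)) := by
      rw [integral_sub hyi hxi, hye, hxe, add_sub_add_left_eq_sub]
    rw [hdiff, ← hIoo _ t ht.1]
    refine norm_integral_le_of_norm_le
      ((intervalIntegrable_iff_integrableOn_Ioo_of_le ht.1).1 hgi) ?_
    refine (ae_restrict_iff' measurableSet_Ioo).2 (Eventually.of_forall fun s hs => ?_)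
    rw [← smul_sub, ← map_sub, norm_smul, Real.norm_eq_abs, mul_comm C, mul_assoc]
    gcongr
    refine (T (t - s)).le_of_opNorm_le (T.norm_le_of_mem_Icc hM0 hT ⟨?_, ?_⟩) _
    · linarith [hs.2]
    · linarith [hs.1, ht.2]
  · intro t ht
    have hUle : U t ≤ M * ∫ s in Set.Ioo 0 t, |u s| := by
      rw [hIoo _ t ht]
      have h := intervalIntegral.abs_integral_le_integral_abs (f := u) (μ := volume) ht
      have h0 : 0 ≤ ∫ s in (0 : ℝ)..t, |u s| := (abs_nonneg _).trans h
      exact (le_abs_self _).trans (h.trans (le_mul_of_one_le_left h0 hM))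
    calc ‖x t‖ = Real.exp (U t) * ‖T t x₀‖ := by
          rw [hx, norm_smul, Real.norm_eq_abs, Real.abs_exp]
      _ ≤ Real.exp (M * ∫ s in Set.Ioo 0 t, |u s|) * (M * Real.exp (-ω * t) * ‖x₀‖) := by
          gcongr
          exact (T t).le_of_opNorm_le (hT t ht) _
      _ = _ := by ring
end

section
/- Let X, X̃, U₁, U₂ be Banach spaces, let T be a C₀-semigroup of type (M,ω) on X (M ≥ 1, ω ∈ ℝ), let B₁ : X̃ → X and B₂ : U₂ → X be bounded linear operators, and let F : X × U₁ → X̃ satisfy the standing assumptions with bound m > 0. Then for every x₀ ∈ X, u₁ ∈ L¹_loc(0,∞;U₁) and u₂ ∈ L¹_loc(0,∞;U₂) there exists a unique continuous x : [0,∞) → X with x(t) = T(t)x₀ + ∫₀ᵗ T(t−s)(B₁F(x(s),u₁(s)) + B₂u₂(s)) ds for all t ≥ 0, and it satisfies ‖x(t)‖ ≤ ( M e^{−ωt} ‖x₀‖ + M ‖B₂‖ ∫₀ᵗ e^{−ω(t−s)} ‖u₂(s)‖ ds ) · exp( m M ‖B₁‖ ∫₀ᵗ ‖u₁(s)‖ ds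 ) for all t ≥ 0. In particular, if ω > 0 the bilinear system with bounded control operators is integral input-to-state stable. -/
open MeasureTheory Set Filter

open scoped Topology NNReal

/-- Integrability on `(0, t)` for every `t > 0`. -/
def LocIntegrable {E : Type*} [NormedAddCommGroup E] (f : ℝ → E) : Prop :=
  ∀ t : ℝ, 0 < t → IntegrableOn f (Ioo 0 t)

theorem LocIntegrable.integrableOn {E : Type*} [NormedAddCommGroup E] {f : ℝ → E}
    (hf : LocIntegrable f) (t : ℝ) : IntegrableOn f (Ioo 0 t) := by
  rcases lt_or_ge 0 t with h | h
  · exact hf t h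
  · simp [Ioo_eq_empty_of_le h]

theorem LocIntegrable.const_mul {f : ℝ → ℝ} (hf : LocIntegrable f) (c : ℝ) :
    LocIntegrable (fun s => c * f s) :=
  fun t ht => (hf t ht).const_mul c

theorem LocIntegrable.continuous_mul {f g : ℝ → ℝ} (hf : LocIntegrable f) (hg : Continuous g) :
    LocIntegrable (fun s => g s * f s) := fun t ht => by
  obtain ⟨C, hC⟩ := isCompact_Icc.exists_bound_of_continuousOn
    (hg.continuousOn (s := Icc 0 t))
  refine Integrable.bdd_mul (hf t ht) hg.aestronglyMeasurable.restrict (c := C) ?_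
  filter_upwards [ae_restrict_mem measurableSet_Ioo] with s hs
  exact hC s (Ioo_subset_Icc_self hs)

/-- Postcomposition with a Lipschitz map preserves absolute continuity. -/
theorem AbsolutelyContinuousOnInterval.lipschitzOnWith_comp_s12 {f g : ℝ → ℝ} {a b : ℝ} {C : ℝ≥0}
    (hf : AbsolutelyContinuousOnInterval f a b) (hg : LipschitzOnWith C g (f '' uIcc a b)) :
    AbsolutelyContinuousOnInterval (g ∘ f) a b := by
  have hf' := hf.const_mul (C : ℝ)
  refine squeeze_zero' (Eventually.of_forall fun E => Finset.sum_nonneg fun i _ => dist_nonneg)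
    ?_ hf'
  rw [eventually_inf_principal]
  filter_upwards with E hE
  refine Finset.sum_le_sum fun i hi => ?_
  have h := hE.1 i (by simpa using hi)
  refine (hg.dist_le_mul _ (mem_image_of_mem f h.1) _ (mem_image_of_mem f h.2)).trans_eq ?_
  rw [Real.dist_eq, Real.dist_eq, ← mul_sub, abs_mul, NNReal.abs_eq]

theorem integral_mul_exp_integral_s12 {k : ℝ → ℝ} {t : ℝ} (ht : 0 ≤ t)
    (hk : IntegrableOn k (Ioo 0 t)) :
    ∫ s in Ioo 0 t, k s * Real.exp (∫ r in Ioo 0 s, k r) =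
      Real.exp (∫ s in Ioo 0 t, k s) - 1 := by
  have hk' : IntervalIntegrable k volume 0 t := by
    rwa [intervalIntegrable_iff_integrableOn_Ioo_of_le ht]
  have hconv : ∀ (f : ℝ → ℝ) (s : ℝ), 0 ≤ s → ∫ r in Ioo 0 s, f r = ∫ r in 0..s, f r :=
    fun f s hs => by rw [intervalIntegral.integral_of_le hs, integral_Ioc_eq_integral_Ioo]
  have hac := hk'.absolutelyContinuousOnInterval_intervalIntegral (c := 0) (by simp)
  have hcomp : AbsolutelyContinuousOnInterval
      (Real.exp ∘ fun s => ∫ r in 0..s, k r) 0 t := by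
    obtain ⟨C, hC⟩ := hac.exists_bound
    obtain ⟨L, hL⟩ := (Real.contDiff_exp (n := 1)).contDiffOn.exists_lipschitzOnWith
      (s := Icc (-C) C) one_ne_zero (convex_Icc _ _) isCompact_Icc
    refine hac.lipschitzOnWith_comp_s12 (hL.mono ?_)
    rintro _ ⟨s, hs, rfl⟩
    exact abs_le.mp (hC s hs)
  have := hcomp.integral_deriv_eq_sub
  simp only [Function.comp, intervalIntegral.integral_same, Real.exp_zero] at this
  rw [hconv k t ht, ← this, hconv _ t ht]
  apply intervalIntegral.integral_congr_ae
  filter_upwards [hk'.ae_hasDerivAt_integral] with s hs hst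
  have h1 := (hs (uIoc_subset_uIcc hst) 0 (by simp)).exp.deriv
  rw [uIoc_of_le ht] at hst
  rw [mul_comm, hconv k s hst.1.le, ← h1]
  rfl

/-- Continuity of an integral whose integrand and domain both depend on a parameter. -/
theorem continuous_integral_Ioo {E : Type*} [NormedAddCommGroup E] [NormedSpace ℝ E]
    {H : ℝ → ℝ → E} {g : ℝ → ℝ} (hg : LocIntegrable g)
    (hmeas : ∀ t τ, AEStronglyMeasurable (H t) (volume.restrict (Ioo 0 τ)))
    (hcont : ∀ s, Continuous fun t => H t s)
    (hbound : ∀ τ, ∃ C, ∀ t ≤ τ, ∀ s, 0 < s → ‖H t s‖ ≤ C * g s) :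
    Continuous fun t => ∫ s in Ioo 0 t, H t s := by
  rw [continuous_iff_continuousAt]
  intro t₀
  obtain ⟨C, hC⟩ := hbound (t₀ + 1)
  have hev : ∀ᶠ t in 𝓝 t₀, t ≤ t₀ + 1 := eventually_le_nhds (by linarith)
  have key : ∀ t ≤ t₀ + 1, ∫ s in Ioo 0 t, H t s =
      ∫ s in Ioo 0 (t₀ + 1), (Iio t).indicator (H t) s := by
    intro t ht
    rw [setIntegral_indicator measurableSet_Iio]
    congr 2
    ext s
    simp only [mem_Ioo, mem_inter_iff, mem_Iio]
    constructor
    · rintro ⟨h1, h2⟩; exact ⟨⟨h1, by linarith⟩, h2⟩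
    · rintro ⟨⟨h1, _⟩, h2⟩; exact ⟨h1, h2⟩
  refine ContinuousAt.congr (f := fun t =>
    ∫ s in Ioo 0 (t₀ + 1), (Iio t).indicator (H t) s) ?_ ?_
  · refine tendsto_integral_filter_of_dominated_convergence (fun s => C * g s) ?_ ?_
      ((hg.const_mul C).integrableOn _) ?_
    · exact Eventually.of_forall fun t => (hmeas t _).indicator measurableSet_Iio
    · filter_upwards [hev] with t ht
      filter_upwards [ae_restrict_mem measurableSet_Ioo] with s hs
      exact (norm_indicator_le_norm_self _ _).trans (hC t ht s hs.1)
    · filter_upwards [Measure.ae_ne (volume.restrict (Ioo 0 (t₀ + 1))) t₀] with s hs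
      rcases lt_or_gt_of_ne hs with h | h
      · have : (Iio t₀).indicator (H t₀) s = H t₀ s :=
          indicator_of_mem (s := Iio t₀) h _
        rw [this]
        refine ((hcont s).tendsto t₀).congr' ?_
        filter_upwards [lt_mem_nhds h] with t ht
        exact (indicator_of_mem (s := Iio t) ht _).symm
      · have : (Iio t₀).indicator (H t₀) s = 0 :=
          indicator_of_notMem (s := Iio t₀) (by simpa using h.le) _
        rw [this]
        refine tendsto_const_nhds.congr' ?_
        filter_upwards [gt_mem_nhds h] with t ht
        exact (indicator_of_notMem (s := Iio t) (by simpa using ht.le) _).symm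
  · filter_upwards [hev] with t ht
    exact (key t ht).symm

theorem LocIntegrable.continuous_integral {k : ℝ → ℝ} (hk : LocIntegrable k) :
    Continuous fun t => ∫ s in Ioo 0 t, k s :=
  continuous_integral_Ioo (H := fun _ => k) (g := fun s => ‖k s‖) (fun t ht => (hk t ht).norm)
    (fun _ τ => (hk.integrableOn τ).aestronglyMeasurable) (fun _ => continuous_const)
    (fun _ => ⟨1, fun _ _ _ _ => by simp⟩)

/-- A continuous function dominated by its own integral against an integrable weight vanishes. -/
theorem eqOn_zero_of_le_integral_mul {k z : ℝ → ℝ} {τ : ℝ} (hk : LocIntegrable k)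
    (hk0 : ∀ s, 0 ≤ k s) (hz : ContinuousOn z (Icc 0 τ)) (hz0 : ∀ t ∈ Icc 0 τ, 0 ≤ z t)
    (hle : ∀ t ∈ Icc 0 τ, z t ≤ ∫ s in Ioo 0 t, k s * z s) :
    ∀ t ∈ Icc 0 τ, z t = 0 := by
  intro t ht
  set Q : ℝ → ℝ := fun t => ∫ s in Ioo 0 t, k s with hQ
  have hQc : Continuous Q := hk.continuous_integral
  obtain ⟨t₁, ht₁, hmax⟩ := isCompact_Icc.exists_isMaxOn ⟨t, ht⟩
    (f := fun t => Real.exp (-Q t) * z t) ((by fun_prop : Continuous _).continuousOn.mul hz)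
  set W := Real.exp (-Q t₁) * z t₁ with hW
  have hzW : ∀ s ∈ Icc 0 τ, z s ≤ W * Real.exp (Q s) := fun s hs => by
    have h : Real.exp (-Q s) * z s ≤ W := hmax hs
    calc z s = (Real.exp (-Q s) * z s) * Real.exp (Q s) := by
          rw [Real.exp_neg]; field_simp
      _ ≤ _ := by gcongr
  have hint : IntegrableOn (fun s => k s * Real.exp (Q s)) (Ioo 0 t₁) := by
    have := (hk.continuous_mul (g := fun s => Real.exp (Q s)) (by fun_prop)).integrableOn t₁
    simpa only [mul_comm] using this
  have h1 : z t₁ ≤ W * (Real.exp (Q t₁) - 1) := by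
    refine (hle t₁ ht₁).trans ?_
    rw [hQ, ← integral_mul_exp_integral_s12 ht₁.1 (hk.integrableOn t₁), ← integral_const_mul]
    refine integral_mono_of_nonneg ?_ (hint.const_mul W) ?_
    · filter_upwards [ae_restrict_mem measurableSet_Ioo] with s hs
      exact mul_nonneg (hk0 s) (hz0 s ⟨hs.1.le, hs.2.le.trans ht₁.2⟩)
    · filter_upwards [ae_restrict_mem measurableSet_Ioo] with s hs
      have := mul_le_mul_of_nonneg_left (hzW s ⟨hs.1.le, hs.2.le.trans ht₁.2⟩) (hk0 s)
      calc k s * z s ≤ k s * (W * Real.exp (Q s)) := this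
        _ = _ := by ring
  have h2 : z t₁ = W * Real.exp (Q t₁) := by
    rw [hW, Real.exp_neg]; field_simp
  have hW0 : W ≤ 0 := by linarith
  refine le_antisymm ((hzW t ht).trans ?_) (hz0 t ht)
  exact mul_nonpos_of_nonpos_of_nonneg hW0 (Real.exp_pos _).le

/-- Carathéodory nonlinearities of linear growth that are Lipschitz on bounded sets, with locally
integrable coefficients. -/
structure IsCaratheodory {X : Type*} [NormedAddCommGroup X] (N : ℝ → X → X) (a b : ℝ → ℝ) :
    Prop where
  aestronglyMeasurable : ∀ (τ : ℝ) (x : ℝ → X),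
    AEStronglyMeasurable x (volume.restrict (Ioo 0 τ)) →
      AEStronglyMeasurable (fun s => N s (x s)) (volume.restrict (Ioo 0 τ))
  growth : ∀ s x, ‖N s x‖ ≤ a s * ‖x‖ + b s
  lipschitz : ∀ R : ℝ, ∃ l : ℝ → ℝ, LocIntegrable l ∧ (∀ s, 0 ≤ l s) ∧
    ∀ s x y, ‖x‖ ≤ R → ‖y‖ ≤ R → ‖N s x - N s y‖ ≤ l s * ‖x - y‖
  locIntegrable_left : LocIntegrable a
  locIntegrable_right : LocIntegrable b
  nonneg_left : ∀ s, 0 ≤ a s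
  nonneg_right : ∀ s, 0 ≤ b s

theorem IsCaratheodory.integrableOn {X : Type*} [NormedAddCommGroup X] {N : ℝ → X → X}
    {a b : ℝ → ℝ} (hN : IsCaratheodory N a b) {x : ℝ → X} {τ : ℝ} (hx : ContinuousOn x (Icc 0 τ)) :
    IntegrableOn (fun s => N s (x s)) (Ioo 0 τ) := by
  obtain ⟨R, hR⟩ := isCompact_Icc.exists_bound_of_continuousOn hx
  refine (((hN.locIntegrable_left.integrableOn τ).mul_const R).add
    (hN.locIntegrable_right.integrableOn τ)).mono' ?_ ?_
  · exact hN.aestronglyMeasurable τ x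
      ((hx.mono Ioo_subset_Icc_self).aestronglyMeasurable measurableSet_Ioo)
  · filter_upwards [ae_restrict_mem measurableSet_Ioo] with s hs
    refine (hN.growth s _).trans ?_
    have := mul_le_mul_of_nonneg_left (hR s (Ioo_subset_Icc_self hs)) (hN.nonneg_left s)
    simpa using this

section Semilinear

variable {X : Type*} [NormedAddCommGroup X] [NormedSpace ℝ X]

theorem C0Semigroup.continuous_uncurry (T : C0Semigroup X) {M ω : ℝ}
    (hT : ∀ t : ℝ, 0 ≤ t → ‖T t‖ ≤ M * Real.exp (-ω * t)) :
    Continuous fun p : ℝ × X => T (max p.1 0) p.2 := by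
  rw [continuous_iff_continuousAt]
  rintro ⟨r₀, x₀⟩
  have h1 : Tendsto (fun p : ℝ × X => T (max p.1 0) x₀) (𝓝 (r₀, x₀)) (𝓝 (T (max r₀ 0) x₀)) := by
    have : Continuous fun r : ℝ => T (max r 0) x₀ :=
      (T.continuousOn_apply' x₀).comp_continuous (by fun_prop) fun r => le_max_right r 0
    exact (this.comp continuous_fst).tendsto _
  have h2 : Tendsto (fun p : ℝ × X => T (max p.1 0) (p.2 - x₀)) (𝓝 (r₀, x₀)) (𝓝 0) := by
    refine squeeze_zero_norm
      (a := fun p : ℝ × X => M * Real.exp (-ω * max p.1 0) * ‖p.2 - x₀‖) (fun p => ?_) ?_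
    · exact (ContinuousLinearMap.le_opNorm _ _).trans
        (by gcongr; exact hT _ (le_max_right _ _))
    · have : Continuous fun p : ℝ × X => M * Real.exp (-ω * max p.1 0) * ‖p.2 - x₀‖ := by
        fun_prop
      simpa using this.tendsto (r₀, x₀)
  have := h2.add h1
  simpa [ContinuousAt, map_sub] using this

theorem C0Semigroup.exists_bound (T : C0Semigroup X) {M ω : ℝ} (hM : 0 ≤ M)
    (hT : ∀ t : ℝ, 0 ≤ t → ‖T t‖ ≤ M * Real.exp (-ω * t)) (τ : ℝ) :
    ∃ C > 0, ∀ r ≤ τ, ‖T (max r 0)‖ ≤ C := by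
  refine ⟨M * Real.exp (|ω| * |τ|) + 1, by positivity, fun r hr => ?_⟩
  have hr' : max r 0 ≤ |τ| := max_le (hr.trans (le_abs_self τ)) (abs_nonneg τ)
  refine (hT _ (le_max_right _ _)).trans ((?_ : _ ≤ M * Real.exp (|ω| * |τ|)).trans (by linarith))
  gcongr
  exact neg_le_abs ω

theorem C0Semigroup.integrableOn_convolution (T : C0Semigroup X) {M ω : ℝ} (hM : 0 ≤ M)
    (hT : ∀ t : ℝ, 0 ≤ t → ‖T t‖ ≤ M * Real.exp (-ω * t)) {g : ℝ → X} {τ : ℝ}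
    (hg : IntegrableOn g (Ioo 0 τ)) (t : ℝ) :
    IntegrableOn (fun s => T (max (t - s) 0) (g s)) (Ioo 0 τ) := by
  obtain ⟨C, -, hC⟩ := T.exists_bound hM hT t
  refine (hg.norm.const_mul C).mono' ?_ ?_
  · exact (T.continuous_uncurry hT).comp_aestronglyMeasurable
      ((by fun_prop : Continuous fun s : ℝ => t - s).aestronglyMeasurable.prodMk hg.1)
  · filter_upwards [ae_restrict_mem measurableSet_Ioo] with s hs
    exact (ContinuousLinearMap.le_opNorm _ _).trans
      (by gcongr; exact hC _ (by linarith [hs.1]))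

/-- The right-hand side of the variation of constants formula for `x' = A x + N(t, x)`. -/
noncomputable def mildMap (T : C0Semigroup X) (N : ℝ → X → X) (x₀ : X) (x : ℝ → X) (t : ℝ) : X :=
  T (max t 0) x₀ + ∫ s in Ioo 0 t, T (max (t - s) 0) (N s (x s))

theorem mildMap_eq (T : C0Semigroup X) (N : ℝ → X → X) (x₀ : X) (x : ℝ → X) {t : ℝ}
    (ht : 0 ≤ t) :
    mildMap T N x₀ x t = T t x₀ + ∫ s in Ioo 0 t, T (t - s) (N s (x s)) := by
  rw [mildMap, max_eq_left ht]
  congr 1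
  refine setIntegral_congr_fun measurableSet_Ioo fun s hs => ?_
  simp only [max_eq_left (sub_nonneg.2 hs.2.le)]

theorem mildMap_congr (T : C0Semigroup X) (N : ℝ → X → X) (x₀ : X) {x y : ℝ → X} {t : ℝ}
    (h : EqOn x y (Ioo 0 t)) : mildMap T N x₀ x t = mildMap T N x₀ y t := by
  rw [mildMap, mildMap]
  congr 1
  refine setIntegral_congr_fun measurableSet_Ioo fun s hs => ?_
  simp only [h hs]

theorem continuous_mildMap (T : C0Semigroup X) {M ω : ℝ} (hM : 0 ≤ M)
    (hT : ∀ t : ℝ, 0 ≤ t → ‖T t‖ ≤ M * Real.exp (-ω * t)) {N : ℝ → X → X} (x₀ : X) {x : ℝ → X}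
    (hx : LocIntegrable fun s => N s (x s)) : Continuous (mildMap T N x₀ x) := by
  have hcont := T.continuous_uncurry hT
  refine (hcont.comp (by fun_prop : Continuous fun t : ℝ => (t, x₀))).add
    (continuous_integral_Ioo (g := fun s => ‖N s (x s)‖) (fun t ht => (hx t ht).norm) ?_ ?_ ?_)
  · exact fun t τ => (T.integrableOn_convolution hM hT (hx.integrableOn τ) t).1
  · exact fun s => hcont.comp (by fun_prop : Continuous fun t : ℝ => (t - s, N s (x s)))
  · intro τ
    obtain ⟨C, -, hC⟩ := T.exists_bound hM hT τ
    exact ⟨C, fun t ht s hs => (ContinuousLinearMap.le_opNorm _ _).trans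
      (by gcongr; exact hC _ (by linarith))⟩

theorem norm_mildMap_sub_le (T : C0Semigroup X) {M ω : ℝ} (hM : 0 ≤ M)
    (hT : ∀ t : ℝ, 0 ≤ t → ‖T t‖ ≤ M * Real.exp (-ω * t)) {N : ℝ → X → X} (x₀ : X)
    {x y : ℝ → X} {t C : ℝ} {d : ℝ → ℝ} (hC0 : 0 ≤ C) (hC : ∀ r ≤ t, ‖T (max r 0)‖ ≤ C)
    (hx : IntegrableOn (fun s => N s (x s)) (Ioo 0 t))
    (hy : IntegrableOn (fun s => N s (y s)) (Ioo 0 t))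
    (hd : IntegrableOn d (Ioo 0 t)) (hxy : ∀ s ∈ Ioo 0 t, ‖N s (x s) - N s (y s)‖ ≤ d s) :
    ‖mildMap T N x₀ x t - mildMap T N x₀ y t‖ ≤ ∫ s in Ioo 0 t, C * d s := by
  have hx₁ : IntegrableOn (fun s => T (max (t - s) 0) (N s (x s))) (Ioo 0 t) :=
    T.integrableOn_convolution hM hT hx t
  have hy₁ : IntegrableOn (fun s => T (max (t - s) 0) (N s (y s))) (Ioo 0 t) :=
    T.integrableOn_convolution hM hT hy t
  rw [mildMap, mildMap, add_sub_add_left_eq_sub, ← integral_sub hx₁ hy₁]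
  refine norm_integral_le_of_norm_le (hd.const_mul C) ?_
  filter_upwards [ae_restrict_mem measurableSet_Ioo] with s hs
  rw [← map_sub]
  exact (ContinuousLinearMap.le_opNorm _ _).trans
    (mul_le_mul (hC _ (by linarith [hs.1])) (hxy s hs) (norm_nonneg _) hC0)

/-- Fixed points of the variation of constants formula are unique. -/
theorem IsCaratheodory.eqOn {N : ℝ → X → X} {a b : ℝ → ℝ} (hN : IsCaratheodory N a b)
    (T : C0Semigroup X) {M ω : ℝ} (hM : 0 ≤ M)
    (hT : ∀ t : ℝ, 0 ≤ t → ‖T t‖ ≤ M * Real.exp (-ω * t)) {x₀ : X} {x y : ℝ → X} {τ : ℝ}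
    (hx : ContinuousOn x (Icc 0 τ)) (hx' : EqOn x (mildMap T N x₀ x) (Icc 0 τ))
    (hy : ContinuousOn y (Icc 0 τ)) (hy' : EqOn y (mildMap T N x₀ y) (Icc 0 τ)) :
    EqOn x y (Icc 0 τ) := by
  obtain ⟨R₁, hR₁⟩ := isCompact_Icc.exists_bound_of_continuousOn hx
  obtain ⟨R₂, hR₂⟩ := isCompact_Icc.exists_bound_of_continuousOn hy
  obtain ⟨l, hl, hl0, hlip⟩ := hN.lipschitz (max R₁ R₂)
  obtain ⟨C, hC0, hC⟩ := T.exists_bound hM hT τ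
  have hz : ContinuousOn (fun s => ‖x s - y s‖) (Icc 0 τ) := (hx.sub hy).norm
  obtain ⟨D, hD⟩ := isCompact_Icc.exists_bound_of_continuousOn hz
  have key := eqOn_zero_of_le_integral_mul (hl.const_mul C)
    (fun s => mul_nonneg hC0.le (hl0 s)) hz (fun _ _ => norm_nonneg _) fun t ht => ?_
  · exact fun t ht => sub_eq_zero.1 (norm_eq_zero.1 (key t ht))
  · have hsub : Icc 0 t ⊆ Icc 0 τ := Icc_subset_Icc_right ht.2
    have hsub' : Ioo 0 t ⊆ Icc 0 τ := Ioo_subset_Icc_self.trans hsub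
    simp only [hx' ht, hy' ht]
    refine (norm_mildMap_sub_le T hM hT x₀ (d := fun s => l s * ‖x s - y s‖) hC0.le
      (fun r hr => hC r (hr.trans ht.2)) (hN.integrableOn (hx.mono hsub))
      (hN.integrableOn (hy.mono hsub)) ?_ fun s hs => ?_).trans_eq ?_
    · refine (hl.integrableOn t).mul_bdd
        ((hz.mono hsub').aestronglyMeasurable measurableSet_Ioo) (c := D) ?_
      filter_upwards [ae_restrict_mem measurableSet_Ioo] with s hs
      exact hD s (hsub' hs)
    · exact hlip s _ _ ((hR₁ s (hsub' hs)).trans (le_max_left _ _))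
        ((hR₂ s (hsub' hs)).trans (le_max_right _ _))
    · refine setIntegral_congr_fun measurableSet_Ioo fun s hs => ?_
      simp only [mul_assoc]

/-- The a priori bound for mild solutions, multiplied out by the growth of the semigroup. -/
noncomputable def growthBound (M ω r : ℝ) (a b : ℝ → ℝ) (t : ℝ) : ℝ :=
  Real.exp (-ω * t) * (M * r + ∫ s in Ioo 0 t, M * (Real.exp (ω * s) * b s)) *
    Real.exp (∫ s in Ioo 0 t, M * a s)

theorem continuous_growthBound (M ω r : ℝ) {a b : ℝ → ℝ} (ha : LocIntegrable a)
    (hb : LocIntegrable b) : Continuous (growthBound M ω r a b) := by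
  have h1 := (ha.const_mul M).continuous_integral
  have h2 := ((hb.continuous_mul (g := fun s => Real.exp (ω * s))
    (by fun_prop)).const_mul M).continuous_integral
  unfold growthBound
  fun_prop

theorem growthBound_nonneg {M r : ℝ} (ω : ℝ) {a b : ℝ → ℝ} (hM : 0 ≤ M) (hr : 0 ≤ r)
    (hb : ∀ s, 0 ≤ b s) (t : ℝ) : 0 ≤ growthBound M ω r a b t := by
  have : 0 ≤ ∫ s in Ioo 0 t, M * (Real.exp (ω * s) * b s) :=
    integral_nonneg fun s => by have := hb s; positivity
  unfold growthBound
  positivity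

theorem IsCaratheodory.norm_mildMap_le {N : ℝ → X → X} {a b : ℝ → ℝ}
    (hN : IsCaratheodory N a b) (T : C0Semigroup X) {M ω : ℝ} (hM : 0 ≤ M)
    (hT : ∀ t : ℝ, 0 ≤ t → ‖T t‖ ≤ M * Real.exp (-ω * t)) {x₀ : X} {x : ℝ → X} {t : ℝ}
    (ht : 0 ≤ t) (hx : ∀ s ∈ Ioo 0 t, ‖x s‖ ≤ growthBound M ω ‖x₀‖ a b s) :
    ‖mildMap T N x₀ x t‖ ≤ growthBound M ω ‖x₀‖ a b t := by
  set f : ℝ → ℝ := fun s => M * (Real.exp (ω * s) * b s) with hf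
  set K : ℝ → ℝ := fun t => ∫ s in Ioo 0 t, M * a s with hK
  have hKint := hN.locIntegrable_left.const_mul M
  have hKc : Continuous K := hKint.continuous_integral
  have hfint : LocIntegrable f := (hN.locIntegrable_right.continuous_mul
    (g := fun s => Real.exp (ω * s)) (by fun_prop)).const_mul M
  have hf0 : ∀ s, 0 ≤ f s := fun s => by have := hN.nonneg_right s; positivity
  set A : ℝ := M * ‖x₀‖ + ∫ s in Ioo 0 t, f s with hA
  have hint : IntegrableOn (fun s => M * a s * Real.exp (K s)) (Ioo 0 t) := by
    have := (hKint.continuous_mul (g := fun s => Real.exp (K s)) (by fun_prop)).integrableOn t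
    simpa only [mul_comm] using this
  have hI : ‖∫ s in Ioo 0 t, T (max (t - s) 0) (N s (x s))‖ ≤
      ∫ s in Ioo 0 t, Real.exp (-ω * t) * (A * (M * a s * Real.exp (K s)) + f s) := by
    refine norm_integral_le_of_norm_le
      (((hint.const_mul A).add (hfint.integrableOn t)).const_mul _) ?_
    filter_upwards [ae_restrict_mem measurableSet_Ioo] with s hs
    have hxs : ‖x s‖ ≤ Real.exp (-ω * s) * A * Real.exp (K s) := by
      refine (hx s hs).trans ?_
      have hmono : ∫ r in Ioo 0 s, f r ≤ ∫ r in Ioo 0 t, f r := setIntegral_mono_set (hfint.integrableOn t) (Eventually.of_forall hf0)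
        (Ioo_subset_Ioo_right hs.2.le).eventuallyLE
      exact mul_le_mul_of_nonneg_right (mul_le_mul_of_nonneg_left
        (add_le_add_right hmono _) (Real.exp_pos _).le) (Real.exp_pos _).le
    have hexp : Real.exp (-ω * (t - s)) = Real.exp (-ω * t) * Real.exp (ω * s) := by
      rw [← Real.exp_add]; ring_nf
    have hexp' : Real.exp (ω * s) * Real.exp (-ω * s) = 1 := by
      rw [← Real.exp_add]; simp
    calc ‖T (max (t - s) 0) (N s (x s))‖
        ≤ (M * Real.exp (-ω * (t - s))) * (a s * ‖x s‖ + b s) := by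
          refine (ContinuousLinearMap.le_opNorm _ _).trans ?_
          gcongr
          · rw [max_eq_left (sub_nonneg.2 hs.2.le)]
            exact hT _ (sub_nonneg.2 hs.2.le)
          · exact hN.growth s _
      _ ≤ (M * Real.exp (-ω * (t - s))) *
            (a s * (Real.exp (-ω * s) * A * Real.exp (K s)) + b s) := by
          gcongr
          exact hN.nonneg_left s
      _ = Real.exp (-ω * t) * ((Real.exp (ω * s) * Real.exp (-ω * s)) *
            (A * (M * a s * Real.exp (K s))) + f s) := by
          rw [hexp, hf]; ring
      _ = _ := by rw [hexp', one_mul]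
  have h0 : ‖T (max t 0) x₀‖ ≤ Real.exp (-ω * t) * (M * ‖x₀‖) := by
    rw [max_eq_left ht]
    refine (ContinuousLinearMap.le_opNorm _ _).trans ?_
    calc ‖T t‖ * ‖x₀‖ ≤ (M * Real.exp (-ω * t)) * ‖x₀‖ := by gcongr; exact hT t ht
      _ = _ := by ring
  rw [integral_const_mul, integral_add (hint.const_mul A) (hfint.integrableOn t),
    integral_const_mul, integral_mul_exp_integral_s12 ht (hKint.integrableOn t)] at hI
  calc ‖mildMap T N x₀ x t‖ ≤ _ := norm_add_le_of_le h0 hI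
    _ = Real.exp (-ω * t) * A * Real.exp (K t) := by rw [hA]; ring
    _ = _ := rfl

/-- Existence of a fixed point of the variation of constants formula on a compact interval. The
contraction acts on `y = exp (-Q) • x`, where `Q` is a primitive of the Lipschitz weight. -/
theorem IsCaratheodory.exists_on_Icc [CompleteSpace X] {N : ℝ → X → X} {a b : ℝ → ℝ}
    (hN : IsCaratheodory N a b) (T : C0Semigroup X) {M ω : ℝ} (hM : 0 ≤ M)
    (hT : ∀ t : ℝ, 0 ≤ t → ‖T t‖ ≤ M * Real.exp (-ω * t)) (x₀ : X) {τ : ℝ} (hτ : 0 ≤ τ) :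
    ∃ x : ℝ → X, Continuous x ∧ EqOn x (mildMap T N x₀ x) (Icc 0 τ) ∧
      ∀ t ∈ Icc 0 τ, ‖x t‖ ≤ growthBound M ω ‖x₀‖ a b t := by
  set β := growthBound M ω ‖x₀‖ a b with hβ
  have hβc : Continuous β :=
    continuous_growthBound M ω ‖x₀‖ hN.locIntegrable_left hN.locIntegrable_right
  have hβ0 : ∀ t, 0 ≤ β t := growthBound_nonneg ω hM (norm_nonneg _) hN.nonneg_right
  obtain ⟨R, hR⟩ := isCompact_Icc.exists_bound_of_continuousOn (hβc.continuousOn (s := Icc 0 τ))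
  obtain ⟨l, hl, hl0, hlip⟩ := hN.lipschitz R
  obtain ⟨C, hC0, hC⟩ := T.exists_bound hM hT τ
  have hk : LocIntegrable fun s => 2 * C * l s := hl.const_mul _
  set Q : ℝ → ℝ := fun t => ∫ s in Ioo 0 t, 2 * C * l s with hQ
  have hQc : Continuous Q := hk.continuous_integral
  let lift : C(Icc 0 τ, X) → ℝ → X := fun y s => Real.exp (Q s) • y (projIcc 0 τ hτ s)
  have hlift : ∀ y, Continuous (lift y) := fun y =>
    (Real.continuous_exp.comp hQc).smul (y.continuous.comp continuous_projIcc)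
  have hlift_eq : ∀ y (t : Icc 0 τ), lift y t = Real.exp (Q t) • y t := fun y t => by
    simp only [lift, projIcc_val]
  have hlint : ∀ y, LocIntegrable fun s => N s (lift y s) := fun y t _ =>
    hN.integrableOn (hlift y).continuousOn
  let Φ : C(Icc 0 τ, X) → C(Icc 0 τ, X) := fun y =>
    ⟨fun t => Real.exp (-Q t) • mildMap T N x₀ (lift y) t,
      ((Real.continuous_exp.comp hQc.neg).smul
        (continuous_mildMap T hM hT x₀ (hlint y))).comp continuous_subtype_val⟩
  let A : Set C(Icc 0 τ, X) := {y | ∀ t : Icc 0 τ, ‖y t‖ ≤ Real.exp (-Q t) * β t}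
  have hexp : ∀ s, Real.exp (Q s) * Real.exp (-Q s) = 1 := fun s => by
    rw [← Real.exp_add]; simp
  have hliftA : ∀ y ∈ A, ∀ s ∈ Icc 0 τ, ‖lift y s‖ ≤ β s := fun y hy s hs => by
    rw [hlift_eq y ⟨s, hs⟩, norm_smul, Real.norm_of_nonneg (Real.exp_pos _).le]
    calc Real.exp (Q s) * ‖y ⟨s, hs⟩‖
        ≤ Real.exp (Q s) * (Real.exp (-Q s) * β s) := by gcongr; exact hy ⟨s, hs⟩
      _ = β s := by rw [← mul_assoc, hexp, one_mul]
  have hA : IsComplete A := by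
    refine IsClosed.isComplete ?_
    simp only [A, ofPred_forall]
    exact isClosed_iInter fun t => isClosed_le (by fun_prop) continuous_const
  have hmaps : MapsTo Φ A A := fun y hy t => by
    change ‖Real.exp (-Q t) • mildMap T N x₀ (lift y) t‖ ≤ _
    rw [norm_smul, Real.norm_of_nonneg (Real.exp_pos _).le]
    gcongr
    exact hN.norm_mildMap_le T hM hT t.2.1 fun s hs =>
      hliftA y hy s ⟨hs.1.le, hs.2.le.trans t.2.2⟩
  have hcontr : ContractingWith (1 / 2) (hmaps.restrict Φ A A) := by
    refine ⟨by norm_num, LipschitzWith.of_dist_le_mul ?_⟩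
    rintro ⟨y, hy⟩ ⟨z, hz⟩
    change dist (Φ y) (Φ z) ≤ ((1 / 2 : ℝ≥0) : ℝ) * dist y z
    refine (ContinuousMap.dist_le (by positivity)).2 fun t => ?_
    have ht := t.2
    have hd : LocIntegrable fun s => dist y z * (Real.exp (Q s) * l s) :=
      (hl.continuous_mul (g := fun s => Real.exp (Q s)) (by fun_prop)).const_mul _
    have h1 : ‖mildMap T N x₀ (lift y) t - mildMap T N x₀ (lift z) t‖ ≤
        ∫ s in Ioo 0 (t : ℝ), C * (dist y z * (Real.exp (Q s) * l s)) := by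
      refine norm_mildMap_sub_le T hM hT x₀ hC0.le (fun r hr => hC r (hr.trans ht.2))
        ((hlint y).integrableOn _) ((hlint z).integrableOn _) (hd.integrableOn _) fun s hs => ?_
      have hs' : s ∈ Icc 0 τ := ⟨hs.1.le, hs.2.le.trans ht.2⟩
      have hβR : β s ≤ R := (le_abs_self _).trans (hR s hs')
      refine (hlip s _ _ ((hliftA y hy s hs').trans hβR)
        ((hliftA z hz s hs').trans hβR)).trans ?_
      rw [hlift_eq y ⟨s, hs'⟩, hlift_eq z ⟨s, hs'⟩, ← smul_sub, norm_smul,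
        Real.norm_of_nonneg (Real.exp_pos _).le, ← dist_eq_norm]
      calc l s * (Real.exp (Q s) * dist (y ⟨s, hs'⟩) (z ⟨s, hs'⟩))
          ≤ l s * (Real.exp (Q s) * dist y z) := by
            gcongr
            · exact hl0 s
            · exact ContinuousMap.dist_apply_le_dist _
        _ = _ := by ring
    have h2 : ∫ s in Ioo 0 (t : ℝ), C * (dist y z * (Real.exp (Q s) * l s)) =
        dist y z / 2 * (Real.exp (Q t) - 1) := by
      rw [hQ, ← integral_mul_exp_integral_s12 ht.1 (hk.integrableOn t), ← integral_const_mul]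
      congr 1
      ext s
      ring
    rw [h2] at h1
    change dist (Real.exp (-Q t) • mildMap T N x₀ (lift y) t)
      (Real.exp (-Q t) • mildMap T N x₀ (lift z) t) ≤ _
    rw [dist_eq_norm, ← smul_sub, norm_smul, Real.norm_of_nonneg (Real.exp_pos _).le]
    calc _ ≤ Real.exp (-Q t) * (dist y z / 2 * (Real.exp (Q t) - 1)) := by gcongr
      _ = dist y z / 2 * (Real.exp (Q t) * Real.exp (-Q t) - Real.exp (-Q t)) := by ring
      _ ≤ dist y z / 2 * 1 := by
          gcongr
          rw [hexp]
          linarith [Real.exp_pos (-Q t)]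
      _ = _ := by push_cast; ring
  have h0 : (0 : C(Icc 0 τ, X)) ∈ A := fun t => by
    have := hβ0 t
    simp only [ContinuousMap.zero_apply, norm_zero]
    positivity
  obtain ⟨y, hyA, hy, -⟩ := hcontr.exists_fixedPoint' hA hmaps h0 (edist_ne_top _ _)
  refine ⟨lift y, hlift y, fun t ht => ?_, hliftA y hyA⟩
  have h := congrArg (fun w : C(Icc 0 τ, X) => w ⟨t, ht⟩) hy
  change Real.exp (-Q t) • mildMap T N x₀ (lift y) t = y ⟨t, ht⟩ at h
  rw [hlift_eq y ⟨t, ht⟩, ← h, smul_smul, hexp, one_smul]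

/-- Global existence for the variation of constants formula, with the a priori bound. -/
theorem IsCaratheodory.exists_global [CompleteSpace X] {N : ℝ → X → X} {a b : ℝ → ℝ}
    (hN : IsCaratheodory N a b) (T : C0Semigroup X) {M ω : ℝ} (hM : 0 ≤ M)
    (hT : ∀ t : ℝ, 0 ≤ t → ‖T t‖ ≤ M * Real.exp (-ω * t)) (x₀ : X) :
    ∃ x : ℝ → X, ContinuousOn x (Ici 0) ∧ EqOn x (mildMap T N x₀ x) (Ici 0) ∧
      ∀ t, 0 ≤ t → ‖x t‖ ≤ growthBound M ω ‖x₀‖ a b t := by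
  choose x hxc hx hxb using fun n : ℕ =>
    hN.exists_on_Icc T hM hT x₀ (τ := (n : ℝ)) (Nat.cast_nonneg n)
  have hle : ∀ {m n : ℕ}, m ≤ n → EqOn (x m) (x n) (Icc 0 m) := fun {m n} hmn => by
    have hsub : Icc (0 : ℝ) m ⊆ Icc (0 : ℝ) n := Icc_subset_Icc_right (by exact_mod_cast hmn)
    exact hN.eqOn T hM hT (hxc m).continuousOn (hx m) (hxc n).continuousOn ((hx n).mono hsub)
  set w : ℝ → X := fun t => x ⌈t⌉₊ t with hw
  have hwx : ∀ n : ℕ, EqOn w (x n) (Icc 0 n) := fun n t ht =>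
    hle (Nat.ceil_le.2 ht.2) ⟨ht.1, Nat.le_ceil t⟩
  refine ⟨w, fun t ht => ?_, fun t ht => ?_, fun t ht => ?_⟩
  · obtain ⟨n, hn⟩ := exists_nat_gt t
    refine ((hxc n).continuousWithinAt (s := Ici 0) (x := t)).congr_of_eventuallyEq ?_
      (hwx n ⟨ht, hn.le⟩)
    filter_upwards [self_mem_nhdsWithin, mem_nhdsWithin_of_mem_nhds (gt_mem_nhds hn)]
      with s hs hsn
    exact hwx n ⟨hs, le_of_lt hsn⟩
  · have htn : t ∈ Icc (0 : ℝ) ⌈t⌉₊ := ⟨ht, Nat.le_ceil t⟩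
    rw [mildMap_congr T N x₀ (y := x ⌈t⌉₊) fun s hs =>
      hwx _ ⟨hs.1.le, hs.2.le.trans htn.2⟩]
    exact hx _ htn
  · exact hxb _ t ⟨ht, Nat.le_ceil t⟩

end Semilinear

section Bilinear

variable {X Xt U₁ U₂ : Type*} [NormedAddCommGroup X] [NormedSpace ℝ X]
  [NormedAddCommGroup Xt] [NormedSpace ℝ Xt] [NormedAddCommGroup U₁] [NormedSpace ℝ U₁]
  [NormedAddCommGroup U₂] [NormedSpace ℝ U₂]

theorem StandingAssumptions.aestronglyMeasurable {m : ℝ} {F : X → U₁ → Xt}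
    (hF : StandingAssumptions m F) {μ : Measure ℝ} {x : ℝ → X} {u : ℝ → U₁}
    (hx : AEStronglyMeasurable x μ) (hu : AEStronglyMeasurable u μ) :
    AEStronglyMeasurable (fun s => F (x s) (u s)) μ := by
  refine ⟨_, hF.stronglyMeasurable_comp _ _ hx.stronglyMeasurable_mk hu.stronglyMeasurable_mk, ?_⟩
  filter_upwards [hx.ae_eq_mk, hu.ae_eq_mk] with s h1 h2
  rw [← h1, ← h2]

theorem StandingAssumptions.isCaratheodory {m : ℝ} (hm : 0 ≤ m) {F : X → U₁ → Xt}
    (hF : StandingAssumptions m F) (B₁ : Xt →L[ℝ] X) (B₂ : U₂ →L[ℝ] X) {u₁ : ℝ → U₁}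
    {u₂ : ℝ → U₂} (hu₁ : LocIntegrable u₁) (hu₂ : LocIntegrable u₂) :
    IsCaratheodory (fun s x => B₁ (F x (u₁ s)) + B₂ (u₂ s)) (fun s => m * ‖B₁‖ * ‖u₁ s‖)
      (fun s => ‖B₂‖ * ‖u₂ s‖) where
  aestronglyMeasurable τ x hx :=
    (B₁.continuous.comp_aestronglyMeasurable
      (hF.aestronglyMeasurable hx (hu₁.integrableOn τ).1)).add
    (B₂.continuous.comp_aestronglyMeasurable (hu₂.integrableOn τ).1)
  growth s x := by
    refine norm_add_le_of_le ?_ (B₂.le_opNorm _)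
    calc ‖B₁ (F x (u₁ s))‖ ≤ ‖B₁‖ * ‖F x (u₁ s)‖ := B₁.le_opNorm _
      _ ≤ ‖B₁‖ * (m * ‖x‖ * ‖u₁ s‖) := by gcongr; exact hF.norm_bound _ _
      _ = _ := by ring
  lipschitz R := by
    obtain ⟨L, hL, h⟩ := hF.lipschitz (Metric.closedBall 0 R) Metric.isBounded_closedBall
    refine ⟨fun s => ‖B₁‖ * L * ‖u₁ s‖, fun t ht => (hu₁ t ht).norm.const_mul _,
      fun s => by positivity, fun s x y hx hy => ?_⟩
    rw [add_sub_add_right_eq_sub, ← map_sub]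
    calc ‖B₁ (F x (u₁ s) - F y (u₁ s))‖ ≤ ‖B₁‖ * ‖F x (u₁ s) - F y (u₁ s)‖ := B₁.le_opNorm _
      _ ≤ ‖B₁‖ * (L * ‖u₁ s‖ * ‖x - y‖) := by
          gcongr; exact h x (by simpa using hx) y (by simpa using hy) _
      _ = _ := by ring
  locIntegrable_left t ht := (hu₁ t ht).norm.const_mul _
  locIntegrable_right t ht := (hu₂ t ht).norm.const_mul _
  nonneg_left s := by positivity
  nonneg_right s := by positivity

end Bilinear

/-- The bilinear system with bounded control operators `B₁ : X̃ → X`, `B₂ : U₂ → X`: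
unique global mild solutions exist for locally integrable inputs, with a
Gronwall-type bound; in particular, for `ω > 0` the system is integral ISS. -/
theorem bounded_bilinear_system_iISS
    {X Xt U₁ U₂ : Type*}
    [NormedAddCommGroup X] [NormedSpace ℝ X] [CompleteSpace X]
    [NormedAddCommGroup Xt] [NormedSpace ℝ Xt] [CompleteSpace Xt]
    [NormedAddCommGroup U₁] [NormedSpace ℝ U₁] [CompleteSpace U₁]
    [NormedAddCommGroup U₂] [NormedSpace ℝ U₂] [CompleteSpace U₂]
    (T : C0Semigroup X) (M ω : ℝ) (hM : 1 ≤ M)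
    (hT : ∀ t : ℝ, 0 ≤ t → ‖T t‖ ≤ M * Real.exp (-ω * t))
    (B₁ : Xt →L[ℝ] X) (B₂ : U₂ →L[ℝ] X)
    (m : ℝ) (hm : 0 < m) (F : X → U₁ → Xt) (hF : StandingAssumptions m F)
    (x₀ : X) (u₁ : ℝ → U₁) (u₂ : ℝ → U₂)
    (hu₁ : ∀ t : ℝ, 0 < t → IntegrableOn u₁ (Set.Ioo 0 t))
    (hu₂ : ∀ t : ℝ, 0 < t → IntegrableOn u₂ (Set.Ioo 0 t)) :
    ∃ x : ℝ → X,
      (ContinuousOn x (Set.Ici 0) ∧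
        ∀ t : ℝ, 0 ≤ t →
          IntegrableOn
            (fun s => T (t - s) (B₁ (F (x s) (u₁ s)) + B₂ (u₂ s))) (Set.Ioo 0 t) ∧
          x t = T t x₀ + ∫ s in Set.Ioo 0 t, T (t - s) (B₁ (F (x s) (u₁ s)) + B₂ (u₂ s))) ∧
      (∀ y : ℝ → X,
        (ContinuousOn y (Set.Ici 0) ∧
          ∀ t : ℝ, 0 ≤ t →
            IntegrableOn
              (fun s => T (t - s) (B₁ (F (y s) (u₁ s)) + B₂ (u₂ s))) (Set.Ioo 0 t) ∧
            y t = T t x₀ +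
              ∫ s in Set.Ioo 0 t, T (t - s) (B₁ (F (y s) (u₁ s)) + B₂ (u₂ s))) →
        Set.EqOn y x (Set.Ici 0)) ∧
      ∀ t : ℝ, 0 ≤ t →
        ‖x t‖ ≤
          (M * Real.exp (-ω * t) * ‖x₀‖
            + M * ‖B₂‖ * ∫ s in Set.Ioo 0 t, Real.exp (-ω * (t - s)) * ‖u₂ s‖) *
          Real.exp (m * M * ‖B₁‖ * ∫ s in Set.Ioo 0 t, ‖u₁ s‖) := by
  have hM0 : 0 ≤ M := by linarith
  have hN := hF.isCaratheodory hm.le B₁ B₂ hu₁ hu₂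
  have hint : ∀ y : ℝ → X, ContinuousOn y (Ici 0) → ∀ t : ℝ, IntegrableOn
      (fun s => T (t - s) (B₁ (F (y s) (u₁ s)) + B₂ (u₂ s))) (Ioo 0 t) := fun y hy t => by
    refine (T.integrableOn_convolution hM0 hT
      (hN.integrableOn (hy.mono Icc_subset_Ici_self)) t).congr_fun (fun s hs => ?_)
      measurableSet_Ioo
    simp only [max_eq_left (sub_nonneg.2 hs.2.le)]
  obtain ⟨x, hxc, hx, hxb⟩ := hN.exists_global T hM0 hT x₀
  refine ⟨x, ⟨hxc, fun t ht => ⟨hint x hxc t, ?_⟩⟩, fun y hy t ht => ?_, fun t ht => ?_⟩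
  · exact (hx ht).trans (mildMap_eq T _ x₀ x ht)
  · have hy' : EqOn y (mildMap T (fun s x => B₁ (F x (u₁ s)) + B₂ (u₂ s)) x₀ y) (Icc 0 t) :=
      fun s hs => by
        rw [mildMap_eq T _ x₀ y hs.1]
        exact (hy.2 s hs.1).2
    exact hN.eqOn T hM0 hT (hy.1.mono Icc_subset_Ici_self) hy'
      (hxc.mono Icc_subset_Ici_self) (hx.mono Icc_subset_Ici_self) (right_mem_Icc.2 ht)
  · refine (hxb t ht).trans_eq ?_
    have h1 : ∫ s in Ioo 0 t, M * (Real.exp (ω * s) * (‖B₂‖ * ‖u₂ s‖)) =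
        M * ‖B₂‖ * ∫ s in Ioo 0 t, Real.exp (ω * s) * ‖u₂ s‖ := by
      rw [← integral_const_mul]
      congr 1
      ext s
      ring
    have h2 : ∫ s in Ioo 0 t, Real.exp (-ω * (t - s)) * ‖u₂ s‖ =
        Real.exp (-ω * t) * ∫ s in Ioo 0 t, Real.exp (ω * s) * ‖u₂ s‖ := by
      rw [← integral_const_mul]
      congr 1
      ext s
      rw [← mul_assoc, ← Real.exp_add]
      ring_nf
    have h3 : ∫ s in Ioo 0 t, M * (m * ‖B₁‖ * ‖u₁ s‖) =
        m * M * ‖B₁‖ * ∫ s in Ioo 0 t, ‖u₁ s‖ := by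
      rw [← integral_const_mul]
      congr 1
      ext s
      ring
    rw [growthBound, h1, h2, h3]
    ring
end

section
/- For every p ∈ [1,∞) there exists t > 0 such that sup{ Σ_{n=1}^∞ (4ⁿ/n⁴) (∫₀ᵗ e^{−2ⁿ(t−s)} u(s) ds)² : u ∈ L^p(0,t;ℝ), ‖u‖_{L^p(0,t)} ≤ 1 } = ∞. Equivalently, there is no p ∈ [1,∞) and no constant K > 0 such that Σ_{n=1}^∞ (4ⁿ/n⁴) (∫₀ᵗ e^{−2ⁿ(t−s)} u(s) ds)² ≤ K² ‖u‖²_{L^p(0,t)} for all t > 0 and all u ∈ L^p(0,t;ℝ). (This expresses that the diagonal control operator with entries bₙ = 2ⁿ/n² is not L^p-admissible for the diagonal semigroup with eigenvalues λₙ = −2ⁿ, for any p ∈ [1,∞).) -/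
open MeasureTheory
open scoped ENNReal

/-- The multiple of the indicator of `(1 - 1 / A, 1)` that has unit `L^p` norm. -/
noncomputable def concentratedInput (p A : ℝ) : ℝ → ℝ :=
  (Set.Ioo (1 - A⁻¹) 1).indicator fun _ => A ^ (1 / p)

lemma Ioo_one_sub_inv_subset {A : ℝ} (hA : 1 ≤ A) : Set.Ioo (1 - A⁻¹) 1 ⊆ Set.Ioo (0 : ℝ) 1 :=
  Set.Ioo_subset_Ioo_left (sub_nonneg.2 (inv_le_one_of_one_le₀ hA))

lemma measurable_concentratedInput (p A : ℝ) : Measurable (concentratedInput p A) :=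
  measurable_const.indicator measurableSet_Ioo

lemma abs_concentratedInput_rpow {p A : ℝ} (hp : 0 < p) (hA : 0 ≤ A) :
    (fun s => |concentratedInput p A s| ^ p) = (Set.Ioo (1 - A⁻¹) 1).indicator fun _ => A := by
  ext s
  by_cases hs : s ∈ Set.Ioo (1 - A⁻¹) 1
  · rw [concentratedInput, Set.indicator_of_mem hs, Set.indicator_of_mem hs,
      abs_of_nonneg (Real.rpow_nonneg hA _), ← Real.rpow_mul hA, one_div_mul_cancel hp.ne',
      Real.rpow_one]
  · rw [concentratedInput, Set.indicator_of_notMem hs, Set.indicator_of_notMem hs, abs_zero,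
      Real.zero_rpow hp.ne']

lemma integrableOn_abs_concentratedInput_rpow {p A : ℝ} (hp : 0 < p) (hA : 0 ≤ A) :
    IntegrableOn (fun s => |concentratedInput p A s| ^ p) (Set.Ioo 0 1) := by
  rw [abs_concentratedInput_rpow hp hA]
  exact (integrableOn_const (by simp)).indicator measurableSet_Ioo

lemma setIntegral_abs_concentratedInput_rpow {p A : ℝ} (hp : 0 < p) (hA : 1 ≤ A) :
    ∫ s in Set.Ioo 0 1, |concentratedInput p A s| ^ p = 1 := by
  have hA₀ : 0 < A := by positivity
  rw [abs_concentratedInput_rpow hp hA₀.le, setIntegral_indicator measurableSet_Ioo,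
    Set.inter_eq_self_of_subset_right (Ioo_one_sub_inv_subset hA)]
  simp [hA₀.le, hA₀.ne']

lemma le_setIntegral_exp_mul_concentratedInput {A : ℝ} (p : ℝ) (hA : 1 ≤ A) :
    Real.exp (-1) * A ^ (1 / p) * A⁻¹ ≤
      ∫ s in Set.Ioo 0 1, Real.exp (-A * (1 - s)) * concentratedInput p A s := by
  have hA₀ : 0 < A := by positivity
  have key : ∫ s in Set.Ioo 0 1, Real.exp (-A * (1 - s)) * concentratedInput p A s =
      ∫ s in Set.Ioo (1 - A⁻¹) 1, Real.exp (-A * (1 - s)) * A ^ (1 / p) := by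
    simp_rw [concentratedInput, ← Set.indicator_mul_right _ fun s => Real.exp (-A * (1 - s))]
    rw [setIntegral_indicator measurableSet_Ioo,
      Set.inter_eq_self_of_subset_right (Ioo_one_sub_inv_subset hA)]
  have hconst : Real.exp (-1) * A ^ (1 / p) * A⁻¹ =
      ∫ _ in Set.Ioo (1 - A⁻¹) 1, Real.exp (-1) * A ^ (1 / p) := by
    simp [hA₀.le, mul_comm]
  rw [key, hconst]
  refine setIntegral_mono_on (integrableOn_const (by simp)) ?_ measurableSet_Ioo fun s hs => ?_
  · exact (Continuous.integrableOn_Icc (by fun_prop)).mono_set Set.Ioo_subset_Icc_self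
  · gcongr
    have : A * (1 - s) ≤ A * A⁻¹ := by
      gcongr
      linarith [hs.1]
    rw [mul_inv_cancel₀ hA₀.ne'] at this
    linarith

lemma tendsto_pow_div_pow_const_atTop {r : ℝ} (k : ℕ) (hr : 1 < r) :
    Filter.Tendsto (fun n : ℕ => r ^ n / (n : ℝ) ^ k) Filter.atTop Filter.atTop := by
  have h := tendsto_pow_const_div_const_pow_of_one_lt k hr
  have h' : Filter.Tendsto (fun n : ℕ => (n : ℝ) ^ k / r ^ n) Filter.atTop
      (nhdsWithin 0 (Set.Ioi 0)) := by
    refine tendsto_nhdsWithin_iff.2 ⟨h, ?_⟩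
    filter_upwards [Filter.eventually_gt_atTop 0] with n hn
    have : (0 : ℝ) < n := by exact_mod_cast hn
    exact Set.mem_Ioi.2 (by positivity)
  exact h'.inv_tendsto_nhdsGT_zero.congr fun n => inv_div _ _

/-- Non-`L^p`-admissibility (for any `p ∈ [1,∞)`) of the diagonal control operator with
entries `bₙ = 2ⁿ/n²` for the diagonal semigroup with eigenvalues `λₙ = −2ⁿ`: for every
`p ∈ [1,∞)` there is `t > 0` such that the input-to-state maps are unbounded on the unit
ball of `L^p(0,t;ℝ)`. -/
theorem diagonal_not_Lp_admissible :
    ∀ p : ℝ, 1 ≤ p → ∃ t : ℝ, 0 < t ∧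
      sSup {r : ℝ≥0∞ | ∃ u : ℝ → ℝ,
        AEStronglyMeasurable u (volume.restrict (Set.Ioo 0 t)) ∧
        IntegrableOn (fun s => |u s| ^ p) (Set.Ioo 0 t) ∧
        (∫ s in Set.Ioo 0 t, |u s| ^ p) ^ (1 / p) ≤ 1 ∧
        r = ∑' n : ℕ,
          ENNReal.ofReal ((4 : ℝ) ^ (n + 1) / ((n : ℝ) + 1) ^ 4 *
            (∫ s in Set.Ioo 0 t, Real.exp (-(2 : ℝ) ^ (n + 1) * (t - s)) * u s) ^ 2)} = ⊤ := by
  intro p hp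
  have hp₀ : 0 < p := by linarith
  refine ⟨1, one_pos, ENNReal.eq_top_of_forall_nnreal_le fun R => ?_⟩
  have hr : (1 : ℝ) < ((2 : ℝ) ^ (1 / p)) ^ 2 :=
    one_lt_pow₀ (Real.one_lt_rpow one_lt_two (by positivity)) two_ne_zero
  have hlim := ((tendsto_pow_div_pow_const_atTop 4 hr).comp
    (Filter.tendsto_add_atTop_nat 1)).const_mul_atTop (show 0 < Real.exp (-1) ^ 2 by positivity)
  obtain ⟨n, hn⟩ := (hlim.eventually_ge_atTop (R : ℝ)).exists
  have hA : (1 : ℝ) ≤ 2 ^ (n + 1) := one_le_pow₀ one_le_two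
  refine le_sSup_of_le ⟨concentratedInput p (2 ^ (n + 1)),
    (measurable_concentratedInput _ _).aestronglyMeasurable,
    integrableOn_abs_concentratedInput_rpow hp₀ (by positivity),
    by rw [setIntegral_abs_concentratedInput_rpow hp₀ hA, Real.one_rpow], rfl⟩
    (le_trans ?_ (ENNReal.le_tsum n))
  rw [← ENNReal.ofReal_coe_nnreal]
  refine ENNReal.ofReal_le_ofReal (hn.trans ?_)
  calc Real.exp (-1) ^ 2 * ((((2 : ℝ) ^ (1 / p)) ^ 2) ^ (n + 1) / ((n + 1 : ℕ) : ℝ) ^ 4)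
      = 4 ^ (n + 1) / ((n : ℝ) + 1) ^ 4 *
          (Real.exp (-1) * ((2 : ℝ) ^ (n + 1)) ^ (1 / p) * ((2 : ℝ) ^ (n + 1))⁻¹) ^ 2 := by
        have h4 : (4 : ℝ) ^ (n + 1) = (2 ^ (n + 1)) ^ 2 := by
          rw [← pow_mul, mul_comm, pow_mul]
          norm_num
        rw [h4, pow_right_comm, Real.rpow_pow_comm zero_le_two]
        push_cast
        field_simp
    _ ≤ _ := by
        gcongr
        exact le_setIntegral_exp_mul_concentratedInput p hA
end
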